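/- arXiv:1011.1283 — 5 statements merged into one kernel-verified Lean document; each statement's English description precedes it below -/
import Mathlib

section
/- For every T > 0 there exists ε = ε(T) > 0 such that every solution (X, P, β) of the B-model equations of motion whose initial data satisfy ‖⟨x⟩³ β(0,·)‖_{L²(ℝ³)} ≤ ε and ‖P(0)‖ ≤ ε obeys ‖P(t)‖ ≤ T^{-2} for all t ∈ [0, T]. -/
open MeasureTheory Filter Real SchwartzMap

noncomputable section

local notation "ℝ³" => EuclideanSpace ℝ (Fin 3)

/-- Japanese bracket `⟨x⟩ = √(1+‖x‖²)`. -/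
def jbracket (x : ℝ³) : ℝ := Real.sqrt (1 + ‖x‖ ^ 2)

/-- Laplacian of `f` at `x`, as sum of second directional derivatives along the
coordinate directions. -/
def laplacianR3 (f : ℝ³ → ℂ) (x : ℝ³) : ℂ :=
  ∑ i : Fin 3,
    fderiv ℝ (fun y => fderiv ℝ f y (EuclideanSpace.single i (1 : ℝ))) x
      (EuclideanSpace.single i (1 : ℝ))

/-- A solution `(X, P, β)` of the B-model equations of motion:
`X' = P/M₀`, `P' = 2κ ∫ (∇W)(x - X t) Re β(t,x) dx`,
`i ∂ₜ β = -(1/2) Δβ + κ W(· - X t)`, together with the regularity required of a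
solution (twice continuously differentiable in `x`, with `β(t,·)` and its spatial
derivatives bounded locally uniformly in `t`). -/
structure IsBModelSolution (W : 𝓢(ℝ³, ℝ)) (M₀ κ : ℝ)
    (X P : ℝ → ℝ³) (β : ℝ → ℝ³ → ℂ) : Prop where
  smooth_x : ∀ t : ℝ, 0 ≤ t → ContDiff ℝ 2 (β t)
  loc_bdd : ∀ T > (0 : ℝ), ∃ C : ℝ, ∀ t ∈ Set.Icc (0 : ℝ) T, ∀ x : ℝ³,
      ‖β t x‖ ≤ C ∧ ‖fderiv ℝ (β t) x‖ ≤ C ∧ ‖fderiv ℝ (fderiv ℝ (β t)) x‖ ≤ C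
  eqX : ∀ t : ℝ, 0 ≤ t → HasDerivAt X (M₀⁻¹ • P t) t
  eqP : ∀ t : ℝ, 0 ≤ t →
      HasDerivAt P ((2 * κ) • ∫ x : ℝ³, (β t x).re • gradient (W : ℝ³ → ℝ) (x - X t)) t
  eqβ : ∀ t : ℝ, 0 ≤ t → ∀ x : ℝ³,
      HasDerivAt (fun s => β s x)
        (-Complex.I * (-(1 / 2 : ℂ) * laplacianR3 (β t) x + (κ : ℂ) * (W (x - X t) : ℂ))) t


open LineDeriv FourierTransform

/-- Schroedinger multiplier. -/
def schMul (τ : ℝ) (ξ : ℝ³) : ℂ := Complex.exp (((-(2 * π ^ 2 * τ) * ‖ξ‖ ^ 2 : ℝ) : ℂ) * Complex.I)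

lemma expI_iter (n : ℕ) : iteratedDeriv n (fun r : ℝ => Complex.exp ((r : ℂ) * Complex.I)) =
    fun r : ℝ => Complex.I ^ n * Complex.exp ((r : ℂ) * Complex.I) := by
  induction n with
  | zero => simp
  | succ n ih =>
    rw [iteratedDeriv_succ, ih]
    funext r
    have h : HasDerivAt (fun r : ℝ => Complex.exp ((r : ℂ) * Complex.I))
        (Complex.exp ((r : ℂ) * Complex.I) * (1 * Complex.I)) r :=
      (((hasDerivAt_id (r : ℂ)).comp_ofReal).mul_const Complex.I).cexp
    rw [(h.const_mul (Complex.I ^ n)).deriv]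
    ring

lemma expI_temp : (fun r : ℝ => Complex.exp ((r : ℂ) * Complex.I)).HasTemperateGrowth := by
  refine ⟨?_, fun n => ⟨0, 1, fun r => ?_⟩⟩
  · exact (Complex.ofRealCLM.contDiff.mul contDiff_const).cexp
  · rw [norm_iteratedFDeriv_eq_norm_iteratedDeriv, expI_iter]
    simp [Complex.norm_exp_ofReal_mul_I]

lemma schMul_temp (τ : ℝ) : (schMul τ).HasTemperateGrowth := by
  have h : (fun ξ : ℝ³ => -(2 * π ^ 2 * τ) * ‖ξ‖ ^ 2).HasTemperateGrowth := by fun_prop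
  exact expI_temp.comp h

lemma schMul_norm (τ : ℝ) (ξ : ℝ³) : ‖schMul τ ξ‖ = 1 := by
  unfold schMul; exact Complex.norm_exp_ofReal_mul_I _

lemma schMul_zero (ξ : ℝ³) : schMul 0 ξ = 1 := by simp [schMul]

lemma schMul_neg (τ : ℝ) (ξ : ℝ³) : schMul τ (-ξ) = schMul τ ξ := by simp [schMul]

/-- Schroedinger propagator on Schwartz functions. -/
def schU (τ : ℝ) : 𝓢(ℝ³, ℂ) →L[ℂ] 𝓢(ℝ³, ℂ) := fourierMultiplierCLM ℂ (schMul τ)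

lemma schU_zero (g : 𝓢(ℝ³, ℂ)) : schU 0 g = g := by
  have : schMul 0 = fun _ => 1 := by funext ξ; exact schMul_zero ξ
  simp [schU, this]

lemma schU_apply (τ : ℝ) (g : 𝓢(ℝ³, ℂ)) (x : ℝ³) :
    schU τ g x = ∫ ξ, Complex.exp ((2 * π * inner ℝ ξ x : ℝ) * Complex.I) •
      (schMul τ ξ * (𝓕 g) ξ) := by
  rw [schU, fourierMultiplierCLM_apply, fourierInv_coe, Real.fourierInv_eq']
  simp [smulLeftCLM_apply_apply (schMul_temp τ)]

lemma schU_bound (τ : ℝ) (g : 𝓢(ℝ³, ℂ)) (x : ℝ³) :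
    ‖schU τ g x‖ ≤ ∫ ξ, ‖(𝓕 g) ξ‖ := by
  rw [schU_apply]
  refine (norm_integral_le_integral_norm _).trans (le_of_eq ?_)
  congr 1; funext ξ
  rw [norm_smul, norm_mul, schMul_norm, Complex.norm_exp_ofReal_mul_I]; simp

lemma fourier_odd (g : 𝓢(ℝ³, ℂ)) (hg : ∀ x, g (-x) = - g x) (ξ : ℝ³) :
    (𝓕 g) (-ξ) = - (𝓕 g) ξ := by
  rw [fourier_coe, Real.fourier_eq', Real.fourier_eq', ← integral_neg,
    ← integral_neg_eq_self]
  congr 1; funext x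
  simp [hg]

lemma schU_odd (τ : ℝ) (g : 𝓢(ℝ³, ℂ)) (hg : ∀ x, g (-x) = - g x) (x : ℝ³) :
    schU τ g (-x) = - schU τ g x := by
  rw [schU_apply, schU_apply, ← integral_neg, ← integral_neg_eq_self]
  congr 1; funext ξ
  simp [fourier_odd g hg, schMul_neg]

lemma schU_lineDeriv (τ : ℝ) (g : 𝓢(ℝ³, ℂ)) (m : ℝ³) :
    ∂_{m} (schU τ g) = schU τ (∂_{m} g) := by
  have h1 : (fun ξ : ℝ³ => RCLike.ofReal (K := ℂ) (inner ℝ ξ m : ℝ)).HasTemperateGrowth := by fun_prop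
  rw [lineDeriv_eq_fourierMultiplierCLM, lineDeriv_eq_fourierMultiplierCLM, map_smul,
    ← fourierMultiplierCLM_ofReal ℂ (by fun_prop), ← fourierMultiplierCLM_ofReal ℂ (by fun_prop)]
  congr 1
  unfold schU
  rw [fourierMultiplierCLM_fourierMultiplierCLM_apply h1 (schMul_temp τ),
    fourierMultiplierCLM_fourierMultiplierCLM_apply (schMul_temp τ) h1, mul_comm]

lemma schMul_fderiv (τ : ℝ) (ξ m : ℝ³) :
    fderiv ℝ (schMul τ) ξ m =
      (-(4 * π ^ 2 * τ) * Complex.I * (inner ℝ ξ m : ℝ) * schMul τ ξ) := by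
  have h1 : HasFDerivAt (fun ξ : ℝ³ => ‖ξ‖ ^ 2) (2 • (innerSL ℝ ξ)) ξ :=
    (hasStrictFDerivAt_norm_sq ξ).hasFDerivAt
  have h2 := (Complex.ofRealCLM.hasFDerivAt.comp ξ (h1.const_mul (-(2 * π ^ 2 * τ)))).mul_const
    Complex.I
  have h3 := h2.cexp
  have h4 : HasFDerivAt (schMul τ) _ ξ := h3
  rw [h4.fderiv]
  simp [schMul]
  ring

lemma inner_temp (m : ℝ³) : (fun ξ : ℝ³ => (inner ℝ ξ m : ℝ)).HasTemperateGrowth := by fun_prop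

lemma fourier_ld_apply (g : 𝓢(ℝ³, ℂ)) (m ξ : ℝ³) :
    (𝓕 (∂_{m} g)) ξ = (2 * π * Complex.I) * ((inner ℝ ξ m : ℝ) * (𝓕 g) ξ) := by
  rw [fourier_lineDerivOp_eq, smul_apply, smulLeftCLM_apply_apply (inner_temp m)]
  simp

lemma schU_comm (τ : ℝ) (g : 𝓢(ℝ³, ℂ)) (m x : ℝ³) :
    ((inner ℝ x m : ℝ) : ℂ) * schU τ g x =
      schU τ (smulLeftCLM ℂ (fun ξ : ℝ³ => (inner ℝ ξ m : ℝ)) g) x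
        - Complex.I * τ * schU τ (∂_{m} g) x := by
  have key : ∂_{m} (smulLeftCLM ℂ (schMul τ) (𝓕 g)) =
      (-(2 * π * τ) : ℂ) • smulLeftCLM ℂ (schMul τ) (𝓕 (∂_{m} g)) +
      smulLeftCLM ℂ (schMul τ) (𝓕 (-(2 * π * Complex.I) •
        smulLeftCLM ℂ (fun ξ : ℝ³ => (inner ℝ ξ m : ℝ)) g)) := by
    ext ξ
    rw [lineDerivOp_apply_eq_fderiv, ← lineDerivOp_fourier_eq]
    have e : (smulLeftCLM ℂ (schMul τ) (𝓕 g) : ℝ³ → ℂ) = fun ξ => schMul τ ξ * (𝓕 g) ξ := by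
      funext ξ; rw [smulLeftCLM_apply_apply (schMul_temp τ)]; rfl
    rw [e, fderiv_fun_mul ((schMul_temp τ).1.differentiable (by simp) ξ) (𝓕 g).differentiableAt]
    simp only [add_apply, smul_apply, smulLeftCLM_apply_apply (schMul_temp τ), fourier_ld_apply,
      lineDerivOp_apply_eq_fderiv, schMul_fderiv, smul_eq_mul]
    ring
  have h := congrArg (fun f : 𝓢(ℝ³, ℂ) => f x)
    (fourierInv_lineDerivOp_eq (smulLeftCLM ℂ (schMul τ) (𝓕 g)) m)
  have hU : ∀ f, 𝓕⁻ (smulLeftCLM ℂ (schMul τ) (𝓕 f)) = schU τ f := fun f => rfl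
  simp only [key, FourierTransform.fourierInv_add, FourierTransform.fourierInv_smul, hU] at h
  rw [map_smul] at h
  simp only [add_apply, smul_apply, smulLeftCLM_apply_apply (inner_temp m)] at h
  simp only [smul_eq_mul, Complex.real_smul] at h
  have hpi : (2 * π * Complex.I : ℂ) ≠ 0 := by simp [Real.pi_ne_zero]
  apply mul_left_cancel₀ hpi
  linear_combination h + 2 * π * τ * schU τ (∂_{m} g) x * Complex.I_sq

lemma fourier_lap (g : 𝓢(ℝ³, ℂ)) (ξ : ℝ³) :
    (𝓕 (∑ i : Fin 3, (∂_{EuclideanSpace.single i (1 : ℝ)}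
        (∂_{EuclideanSpace.single i (1 : ℝ)} g)))) ξ
      = -(4 * π ^ 2) * ((‖ξ‖ ^ 2 : ℝ) : ℂ) * (𝓕 g) ξ := by
  have : 𝓕 (∑ i : Fin 3, (∂_{EuclideanSpace.single i (1 : ℝ)}
        (∂_{EuclideanSpace.single i (1 : ℝ)} g))) = ∑ i : Fin 3, 𝓕 (∂_{EuclideanSpace.single i (1 : ℝ)}
        (∂_{EuclideanSpace.single i (1 : ℝ)} g)) := by
    simp only [Fin.sum_univ_three, FourierTransform.fourier_add]
  rw [this]
  simp only [Fin.sum_univ_three, add_apply, fourier_ld_apply]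
  rw [EuclideanSpace.norm_sq_eq]
  simp only [Fin.sum_univ_three, EuclideanSpace.inner_single_right, Real.norm_eq_abs, sq_abs,
    conj_trivial, one_mul]
  push_cast
  linear_combination (4 * π ^ 2) * ((ξ 0) ^ 2 + (ξ 1) ^ 2 + (ξ 2) ^ 2) * (𝓕 g) ξ * Complex.I_sq

lemma schU_integrable (x : ℝ³) (τ : ℝ) (f : 𝓢(ℝ³, ℂ)) : Integrable (fun ξ : ℝ³ =>
      Complex.exp ((2 * π * inner ℝ ξ x : ℝ) * Complex.I) • (schMul τ ξ * (𝓕 f) ξ)) := by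
  have hc : Continuous (schMul τ) := (schMul_temp τ).1.continuous
  refine ((𝓕 f).integrable (μ := volume)).norm.mono' ?_ ?_
  · apply Continuous.aestronglyMeasurable
    have := (𝓕 f).continuous
    fun_prop
  · filter_upwards with ξ
    rw [norm_smul, norm_mul, schMul_norm, Complex.norm_exp_ofReal_mul_I]; simp

lemma schU_pt (τ : ℝ) (x ξ : ℝ³) (a b : ℂ) (h2 : b = -(4 * π ^ 2) * ((‖ξ‖ ^ 2 : ℝ) : ℂ) * a) :
    HasDerivAt (fun τ : ℝ => Complex.exp ((2 * π * inner ℝ ξ x : ℝ) * Complex.I) • (schMul τ ξ * a))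
      (Complex.I / 2 * (Complex.exp ((2 * π * inner ℝ ξ x : ℝ) * Complex.I) • (schMul τ ξ * b))) τ := by
  have h3 : HasDerivAt (fun τ : ℝ => (((-(2 * π ^ 2 * τ) * ‖ξ‖ ^ 2 : ℝ) : ℂ) * Complex.I))
      (((-(2 * π ^ 2 * 1) * ‖ξ‖ ^ 2 : ℝ) : ℂ) * Complex.I) τ :=
    (HasDerivAt.ofReal_comp ((((hasDerivAt_id τ).const_mul (2 * π ^ 2)).neg).mul_const
      (‖ξ‖ ^ 2))).mul_const Complex.I
  have h4 : HasDerivAt (fun τ : ℝ => schMul τ ξ)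
    (schMul τ ξ * (((-(2 * π ^ 2 * 1) * ‖ξ‖ ^ 2 : ℝ) : ℂ) * Complex.I)) τ := h3.cexp
  have h5 := (h4.mul_const a).const_smul
    (Complex.exp ((2 * π * inner ℝ ξ x : ℝ) * Complex.I))
  refine h5.congr_deriv ?_
  rw [h2]
  simp only [smul_eq_mul]
  push_cast
  ring

lemma schU_aux0 (τ : ℝ) (x : ℝ³) (a b : ℝ³ → ℂ)
    (ha : ∀ τ, Integrable (fun ξ : ℝ³ =>
      Complex.exp ((2 * π * inner ℝ ξ x : ℝ) * Complex.I) • (schMul τ ξ * a ξ)))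
    (hb : ∀ τ, Integrable (fun ξ : ℝ³ =>
      Complex.exp ((2 * π * inner ℝ ξ x : ℝ) * Complex.I) • (schMul τ ξ * b ξ)))
    (hb' : Integrable b)
    (h2 : ∀ ξ, b ξ = -(4 * π ^ 2) * ((‖ξ‖ ^ 2 : ℝ) : ℂ) * a ξ) :
    HasDerivAt (fun τ => ∫ ξ : ℝ³, Complex.exp ((2 * π * inner ℝ ξ x : ℝ) * Complex.I) • (schMul τ ξ * a ξ))
     (∫ ξ : ℝ³, Complex.I / 2 * (Complex.exp ((2 * π * inner ℝ ξ x : ℝ) * Complex.I) • (schMul τ ξ * b ξ))) τ := by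
  refine (hasDerivAt_integral_of_dominated_loc_of_deriv_le (s := Set.univ) (μ := volume)
    (bound := fun ξ : ℝ³ => ‖(1 / 2 : ℂ) * b ξ‖)
    (F := fun (τ : ℝ) (ξ : ℝ³) => Complex.exp ((2 * π * inner ℝ ξ x : ℝ) * Complex.I) • (schMul τ ξ * a ξ))
    (F' := fun (τ : ℝ) (ξ : ℝ³) => Complex.I / 2 * (Complex.exp ((2 * π * inner ℝ ξ x : ℝ) * Complex.I) • (schMul τ ξ * b ξ)))
    Filter.univ_mem ?_ (ha τ) ?_ ?_ ?_ ?_).2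
  · exact Filter.Eventually.of_forall fun τ => (ha τ).aestronglyMeasurable
  · exact ((hb τ).const_mul _).aestronglyMeasurable
  · filter_upwards with ξ τ _
    rw [norm_mul, norm_smul, norm_mul, schMul_norm, Complex.norm_exp_ofReal_mul_I]; simp
  · exact (hb'.const_mul _).norm
  · exact Filter.Eventually.of_forall fun ξ τ _ => schU_pt τ x ξ _ _ (h2 ξ)

lemma schU_hasDerivAt_aux (τ : ℝ) (g L : 𝓢(ℝ³, ℂ)) (x : ℝ³)
    (h2 : ∀ ξ, (𝓕 L) ξ = -(4 * π ^ 2) * ((‖ξ‖ ^ 2 : ℝ) : ℂ) * (𝓕 g) ξ) :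
    HasDerivAt (fun τ => schU τ g x) (Complex.I / 2 * schU τ L x) τ := by
  have h := schU_aux0 τ x (𝓕 g : 𝓢(ℝ³, ℂ)) (𝓕 L : 𝓢(ℝ³, ℂ)) (fun τ => schU_integrable x τ g)
    (fun τ => schU_integrable x τ L) (𝓕 L : 𝓢(ℝ³, ℂ)).integrable h2
  rw [integral_const_mul, ← schU_apply] at h
  simp only [← schU_apply] at h
  exact h

lemma schU_hasDerivAt (τ : ℝ) (g : 𝓢(ℝ³, ℂ)) (x : ℝ³) :
    HasDerivAt (fun τ => schU τ g x)
      (Complex.I / 2 * ∑ i : Fin 3, schU τ (∂_{EuclideanSpace.single i (1 : ℝ)}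
        (∂_{EuclideanSpace.single i (1 : ℝ)} g)) x) τ := by
  have h1 : ∑ i : Fin 3, schU τ (∂_{EuclideanSpace.single i (1 : ℝ)}
        (∂_{EuclideanSpace.single i (1 : ℝ)} g)) x = schU τ (∑ i : Fin 3, (∂_{EuclideanSpace.single i (1 : ℝ)}
        (∂_{EuclideanSpace.single i (1 : ℝ)} g))) x := by
    rw [map_sum]; simp only [Fin.sum_univ_three, add_apply]
  rw [h1]
  exact schU_hasDerivAt_aux τ g _ x (fourier_lap g)

lemma schU_coord_decay (T : ℝ) (m : ℝ³) (n : ℕ) : ∀ g : 𝓢(ℝ³, ℂ), ∃ C : ℝ, ∀ τ : ℝ, |τ| ≤ T →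
    ∀ x : ℝ³, |inner ℝ x m| ^ n * ‖schU τ g x‖ ≤ C := by
  induction n with
  | zero => intro g; exact ⟨_, fun τ _ x => by simpa using schU_bound τ g x⟩
  | succ n ih =>
    intro g
    obtain ⟨C1, h1⟩ := ih (smulLeftCLM ℂ (fun ξ : ℝ³ => (inner ℝ ξ m : ℝ)) g)
    obtain ⟨C2, h2⟩ := ih (∂_{m} g)
    refine ⟨C1 + T * C2, fun τ hτ x => ?_⟩
    have h := congrArg norm (schU_comm τ g m x)
    rw [norm_mul, Complex.norm_real, Real.norm_eq_abs] at h
    rw [pow_succ, mul_assoc, h]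
    refine (mul_le_mul_of_nonneg_left (norm_sub_le _ _) (by positivity)).trans ?_
    rw [mul_add]
    refine add_le_add (h1 τ hτ x) ?_
    rw [norm_mul, norm_mul, Complex.norm_I, Complex.norm_real, Real.norm_eq_abs, one_mul]
    calc _ = |τ| * (|inner ℝ x m| ^ n * ‖schU τ (∂_{m} g) x‖) := by ring
      _ ≤ T * C2 := mul_le_mul hτ (h2 τ hτ x) (by positivity) ((abs_nonneg _).trans hτ)

/-- Decaying weight. -/
def rho (x : ℝ³) : ℝ := (1 + ‖x‖) ^ (-4 : ℝ)

lemma rho_pos (x : ℝ³) : 0 < rho x := by unfold rho; positivity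

lemma rho_cont : Continuous rho := by
  unfold rho
  refine Continuous.rpow_const (by fun_prop) (fun x => Or.inl ?_)
  positivity

lemma rho_integrable : Integrable rho := by
  apply integrable_one_add_norm
  simp; norm_num

lemma rho_le_one (x : ℝ³) : rho x ≤ 1 := by
  unfold rho
  exact Real.rpow_le_one_of_one_le_of_nonpos (by linarith [norm_nonneg x]) (by norm_num)

lemma rho_memLp : MemLp rho 2 := by
  rw [memLp_two_iff_integrable_sq rho_cont.aestronglyMeasurable]
  refine rho_integrable.mono' (rho_cont.pow 2).aestronglyMeasurable ?_
  filter_upwards with x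
  rw [Real.norm_eq_abs, abs_of_nonneg (sq_nonneg _)]
  nlinarith [rho_le_one x, rho_pos x]

lemma rho_weight (x : ℝ³) (a C : ℝ) (h : (1 + ‖x‖) ^ 4 * a ≤ C) : a ≤ C * rho x := by
  have h0 : 0 < 1 + ‖x‖ := by positivity
  have : rho x = ((1 + ‖x‖) ^ 4)⁻¹ := by
    unfold rho
    rw [Real.rpow_neg h0.le]; norm_cast
  rw [this, ← div_eq_mul_inv, le_div_iff₀ (by positivity)]
  linarith

lemma norm_le_sum_coord (x : ℝ³) : ‖x‖ ≤ |x 0| + |x 1| + |x 2| := by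
  refine (sq_le_sq₀ (norm_nonneg _) (by positivity)).1 ?_
  rw [EuclideanSpace.norm_sq_eq, Fin.sum_univ_three]
  simp only [Real.norm_eq_abs]
  nlinarith [mul_nonneg (abs_nonneg (x 0)) (abs_nonneg (x 1)),
    mul_nonneg (abs_nonneg (x 0)) (abs_nonneg (x 2)), mul_nonneg (abs_nonneg (x 1)) (abs_nonneg (x 2))]

lemma pow4_le (x : ℝ³) : (1 + ‖x‖) ^ 4 ≤ 64 * (1 + |x 0| ^ 4 + |x 1| ^ 4 + |x 2| ^ 4) := by
  have h1 := norm_le_sum_coord x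
  have h2 : (1 + ‖x‖) ^ 4 ≤ ((1 + |x 0|) + (|x 1| + |x 2|)) ^ 4 :=
    pow_le_pow_left₀ (by positivity) (by linarith) 4
  have h3 := add_pow_le (a := 1 + |x 0|) (b := |x 1| + |x 2|) (by positivity) (by positivity) 4
  have h4 := add_pow_le (a := 1) (b := |x 0|) (by positivity) (by positivity) 4
  have h5 := add_pow_le (a := |x 1|) (b := |x 2|) (by positivity) (by positivity) 4
  norm_num at h3 h4 h5 ⊢
  linarith

lemma schU_decay (T : ℝ) (hT : 0 ≤ T) (g : 𝓢(ℝ³, ℂ)) : ∃ C : ℝ, 0 ≤ C ∧ ∀ τ : ℝ, |τ| ≤ T →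
    ∀ x : ℝ³, ‖schU τ g x‖ ≤ C * rho x := by
  have hh := fun i : Fin 3 => schU_coord_decay T (EuclideanSpace.single i (1 : ℝ)) 4 g
  choose C hC using hh
  have key : ∀ τ : ℝ, |τ| ≤ T → ∀ x : ℝ³,
      (1 + ‖x‖) ^ 4 * ‖schU τ g x‖ ≤ 64 * ((∫ ξ, ‖(𝓕 g) ξ‖) + C 0 + C 1 + C 2) := by
    intro τ hτ x
    have h0 := hC 0 τ hτ x
    have h1 := hC 1 τ hτ x
    have h2 := hC 2 τ hτ x
    have hb := schU_bound τ g x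
    simp only [EuclideanSpace.inner_single_right, conj_trivial, one_mul] at h0 h1 h2
    calc _ ≤ 64 * (1 + |x 0| ^ 4 + |x 1| ^ 4 + |x 2| ^ 4) * ‖schU τ g x‖ :=
          mul_le_mul_of_nonneg_right (pow4_le x) (norm_nonneg _)
      _ ≤ _ := by linarith
  refine ⟨_, ?_, fun τ hτ x => rho_weight x _ _ (key τ hτ x)⟩
  exact le_trans (by positivity) (key 0 (by simpa using hT) 0)

lemma lap_translate (b : ℝ³ → ℂ) (a x : ℝ³) :
    laplacianR3 b (x + a) = laplacianR3 (fun y => b (y + a)) x := by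
  unfold laplacianR3
  refine Finset.sum_congr rfl fun i _ => ?_
  have : (fun y => fderiv ℝ (fun y => b (y + a)) y (EuclideanSpace.single i (1 : ℝ))) =
      fun y => (fun z => fderiv ℝ b z (EuclideanSpace.single i (1 : ℝ))) (y + a) := by
    funext y; rw [fderiv_comp_add_right]
  rw [this, fderiv_comp_add_right (f := fun z => fderiv ℝ b z (EuclideanSpace.single i (1 : ℝ)))]

lemma bdd_mul_schwartz {b : ℝ³ → ℂ} (hb : Continuous b) {C : ℝ} (hC : ∀ x, ‖b x‖ ≤ C)
    (φ : 𝓢(ℝ³, ℂ)) : Integrable (fun x => b x * φ x) :=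
  (φ.integrable (μ := volume)).bdd_mul hb.aestronglyMeasurable (Filter.Eventually.of_forall hC)

lemma second_dir (b : ℝ³ → ℂ) (hb : ContDiff ℝ 2 b) (m x : ℝ³) :
    fderiv ℝ (fun y => fderiv ℝ b y m) x m = fderiv ℝ (fderiv ℝ b) x m m := by
  have hd : DifferentiableAt ℝ (fderiv ℝ b) x :=
    (hb.fderiv_right (m := 1) (by norm_num)).differentiable (by norm_num) x
  rw [fderiv_clm_apply hd (differentiableAt_const m)]
  simp

lemma ibp (b : ℝ³ → ℂ) (hb : ContDiff ℝ 2 b) (C : ℝ)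
    (hC : ∀ x, ‖b x‖ ≤ C ∧ ‖fderiv ℝ b x‖ ≤ C ∧ ‖fderiv ℝ (fderiv ℝ b) x‖ ≤ C)
    (φ : 𝓢(ℝ³, ℂ)) (m : ℝ³) (hm : ‖m‖ = 1) :
    Integrable (fun x => fderiv ℝ (fun y => fderiv ℝ b y m) x m * φ x) ∧
    ∫ x, fderiv ℝ (fun y => fderiv ℝ b y m) x m * φ x = ∫ x, b x * (∂_{m} (∂_{m} φ)) x := by
  have c0 : Continuous b := hb.continuous
  have cd1 : ContDiff ℝ 1 (fderiv ℝ b) := hb.fderiv_right (m := 1) (by norm_num)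
  have c1 : Continuous (fun y => fderiv ℝ b y m) := cd1.continuous.clm_apply continuous_const
  have c2 : Continuous (fun y => fderiv ℝ (fun y => fderiv ℝ b y m) y m) := by
    simp_rw [second_dir b hb]
    exact ((cd1.continuous_fderiv (by norm_num)).clm_apply continuous_const).clm_apply
      continuous_const
  have b0 : ∀ x, ‖b x‖ ≤ C := fun x => (hC x).1
  have b1 : ∀ x, ‖fderiv ℝ b x m‖ ≤ C := fun x =>
    ((fderiv ℝ b x).le_opNorm m).trans (by rw [hm, mul_one]; exact (hC x).2.1)
  have b2 : ∀ x, ‖fderiv ℝ (fun y => fderiv ℝ b y m) x m‖ ≤ C := fun x => by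
    rw [second_dir b hb]
    refine ((fderiv ℝ (fderiv ℝ b) x).le_opNorm₂ m m).trans ?_
    rw [hm, mul_one, mul_one]; exact (hC x).2.2
  have hd1 : Differentiable ℝ (fun y => fderiv ℝ b y m) := by
    have := cd1.differentiable (by norm_num)
    fun_prop
  refine ⟨bdd_mul_schwartz c2 b2 φ, ?_⟩
  have e1 : ∫ x, (fderiv ℝ b x m) * fderiv ℝ φ x m = _ :=
    integral_mul_fderiv_eq_neg_fderiv_mul_of_integrable (μ := volume) (f := fun y => fderiv ℝ b y m)
      (g := φ) (v := m)
      (bdd_mul_schwartz c2 b2 φ)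
      (by simp_rw [← lineDerivOp_apply_eq_fderiv]; exact bdd_mul_schwartz c1 b1 _)
      (bdd_mul_schwartz c1 b1 φ) (fun x _ => hd1 x) (fun x _ => φ.differentiableAt)
  have e2 : ∫ x, b x * fderiv ℝ (∂_{m} φ : 𝓢(ℝ³, ℂ)) x m = _ :=
    integral_mul_fderiv_eq_neg_fderiv_mul_of_integrable (μ := volume) (f := b)
      (g := (∂_{m} φ : 𝓢(ℝ³, ℂ))) (v := m)
      (bdd_mul_schwartz c1 b1 _)
      (by simp_rw [← lineDerivOp_apply_eq_fderiv]; exact bdd_mul_schwartz c0 b0 _)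
      (bdd_mul_schwartz c0 b0 _) (fun x _ => hb.differentiable (by norm_num) x)
      (fun x _ => (∂_{m} φ : 𝓢(ℝ³, ℂ)).differentiableAt)
  simp_rw [← lineDerivOp_apply_eq_fderiv] at e1 e2
  rw [e2, e1, neg_neg]

lemma lap_bound (b : ℝ³ → ℂ) (hb : ContDiff ℝ 2 b) (C : ℝ) (x : ℝ³)
    (hC : ‖fderiv ℝ (fderiv ℝ b) x‖ ≤ C) : ‖laplacianR3 b x‖ ≤ 3 * C := by
  unfold laplacianR3
  have h3 : ∑ _i : Fin 3, C = 3 * C := by simp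
  rw [← h3]
  refine norm_sum_le_of_le _ fun i _ => ?_
  rw [second_dir b hb]
  refine ((fderiv ℝ (fderiv ℝ b) x).le_opNorm₂ _ _).trans ?_
  simpa using hC

lemma lap_cont (b : ℝ³ → ℂ) (hb : ContDiff ℝ 2 b) : Continuous (laplacianR3 b) := by
  have cd1 : ContDiff ℝ 1 (fderiv ℝ b) := hb.fderiv_right (m := 1) (by norm_num)
  unfold laplacianR3
  refine continuous_finsetSum _ fun i _ => ?_
  simp_rw [second_dir b hb]
  exact ((cd1.continuous_fderiv (by norm_num)).clm_apply continuous_const).clm_apply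
      continuous_const

lemma ibp_lap (b : ℝ³ → ℂ) (hb : ContDiff ℝ 2 b) (C : ℝ)
    (hC : ∀ x, ‖b x‖ ≤ C ∧ ‖fderiv ℝ b x‖ ≤ C ∧ ‖fderiv ℝ (fderiv ℝ b) x‖ ≤ C)
    (φ : 𝓢(ℝ³, ℂ)) (a : ℝ³) :
    ∫ x, laplacianR3 b (x + a) * φ x = ∫ x, b (x + a) * ∑ i : Fin 3,
      (∂_{EuclideanSpace.single i (1 : ℝ)} (∂_{EuclideanSpace.single i (1 : ℝ)} φ)) x := by
  have hb' : ContDiff ℝ 2 (fun x => b (x + a)) := hb.comp (contDiff_id.add contDiff_const)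
  have f1 : fderiv ℝ (fun x => b (x + a)) = fun x => fderiv ℝ b (x + a) := by
    funext x; rw [fderiv_comp_add_right]
  have hC' : ∀ x, ‖b (x + a)‖ ≤ C ∧ ‖fderiv ℝ (fun x => b (x + a)) x‖ ≤ C ∧
      ‖fderiv ℝ (fderiv ℝ (fun x => b (x + a))) x‖ ≤ C := by
    intro x
    rw [f1, fderiv_comp_add_right (f := fderiv ℝ b)]
    exact hC (x + a)
  have h := fun i : Fin 3 => ibp _ hb' C hC' φ (EuclideanSpace.single i (1 : ℝ)) (by simp)
  simp_rw [lap_translate]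
  unfold laplacianR3
  simp_rw [Finset.sum_mul, Finset.mul_sum]
  rw [integral_finsetSum _ fun i _ => (h i).1, integral_finsetSum]
  · exact Finset.sum_congr rfl fun i _ => (h i).2
  · intro i _
    exact bdd_mul_schwartz hb'.continuous (fun x => (hC' x).1) _

lemma schwartz_bdd (W : 𝓢(ℝ³, ℝ)) : ∃ C : ℝ, 0 ≤ C ∧ ∀ x, ‖W x‖ ≤ C := by
  obtain ⟨C, hC, h⟩ := W.decay 0 0
  exact ⟨C, hC.le, fun x => by simpa using h x⟩

lemma schwartz_lip (W : 𝓢(ℝ³, ℝ)) : ∃ C : ℝ, 0 ≤ C ∧ ∀ x y, ‖W x - W y‖ ≤ C * ‖x - y‖ := by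
  obtain ⟨C, hC, h⟩ := W.decay 0 1
  refine ⟨C, hC.le, fun x y => ?_⟩
  refine Convex.norm_image_sub_le_of_norm_fderiv_le (𝕜 := ℝ) (s := Set.univ)
    (fun z _ => W.differentiableAt) (fun z _ => ?_) convex_univ (Set.mem_univ _) (Set.mem_univ _)
  have := h z
  rwa [pow_zero, one_mul, norm_iteratedFDeriv_one] at this

lemma cs_bound {ε C : ℝ} (hε : 0 ≤ ε) (hC : 0 ≤ C) (f φ : ℝ³ → ℂ) (hf : Continuous f)
    (a : ℝ³) (hφc : Continuous φ)
    (hfε : eLpNorm f 2 volume ≤ ENNReal.ofReal ε) (hφ : ∀ x, ‖φ x‖ ≤ C * rho x) :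
    ‖∫ x, f (x + a) * φ x‖ ≤ ε * (C * (eLpNorm rho 2 volume).toReal) := by
  have h1 : eLpNorm (fun x => f (x + a)) 2 volume ≤ ENNReal.ofReal ε := by
    have := eLpNorm_comp_measurePreserving (p := 2) (f := fun x : ℝ³ => x + a) (μ := volume)
      (ν := volume) (g := f) hf.aestronglyMeasurable (measurePreserving_add_right volume a)
    exact (le_of_eq this).trans hfε
  have h2 : eLpNorm φ 2 volume ≤ ENNReal.ofReal C * eLpNorm rho 2 volume :=
    eLpNorm_le_mul_eLpNorm_of_ae_le_mul (Filter.Eventually.of_forall fun x => by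
      rw [Real.norm_eq_abs, abs_of_pos (rho_pos x)]; exact hφ x) 2
  have h3 := eLpNorm_smul_le_mul_eLpNorm (p := 2) (q := 2) (r := 1) (μ := volume)
    hφc.aestronglyMeasurable
    (φ := fun x => f (x + a)) (hf.comp (continuous_id.add continuous_const)).aestronglyMeasurable
  have h4 : ‖∫ x, f (x + a) * φ x‖ₑ ≤ ENNReal.ofReal ε * (ENNReal.ofReal C * eLpNorm rho 2 volume) := by
    refine (enorm_integral_le_lintegral_enorm _).trans ?_
    rw [eLpNorm_one_eq_lintegral_enorm] at h3
    exact h3.trans (mul_le_mul' h1 h2)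
  have h5 : eLpNorm rho 2 volume ≠ ⊤ := rho_memLp.2.ne
  have h6 := ENNReal.toReal_mono (by finiteness) h4
  rw [ENNReal.toReal_mul, ENNReal.toReal_mul, ENNReal.toReal_ofReal hε, ENNReal.toReal_ofReal hC,
    toReal_enorm] at h6
  exact h6

/-- Second-derivative sum of the propagated test function. -/
def schLap (τ : ℝ) (g : 𝓢(ℝ³, ℂ)) (x : ℝ³) : ℂ :=
  ∑ i : Fin 3, schU τ (∂_{EuclideanSpace.single i (1 : ℝ)}
        (∂_{EuclideanSpace.single i (1 : ℝ)} g)) x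

lemma schLap_cont (τ : ℝ) (g : 𝓢(ℝ³, ℂ)) : Continuous (schLap τ g) :=
  continuous_finsetSum _ fun i _ => (schU τ _).continuous

lemma schLap_decay (T : ℝ) (hT : 0 ≤ T) (g : 𝓢(ℝ³, ℂ)) : ∃ C : ℝ, 0 ≤ C ∧ ∀ τ : ℝ, |τ| ≤ T →
    ∀ x : ℝ³, ‖schLap τ g x‖ ≤ C * rho x := by
  have := fun i : Fin 3 => schU_decay T hT (∂_{EuclideanSpace.single i (1 : ℝ)}
        (∂_{EuclideanSpace.single i (1 : ℝ)} g))
  choose C hC h using this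
  refine ⟨∑ i, C i, Finset.sum_nonneg fun i _ => hC i, fun τ hτ x => ?_⟩
  rw [Finset.sum_mul]
  exact norm_sum_le_of_le _ fun i _ => h i τ hτ x

section duality

variable {W : 𝓢(ℝ³, ℝ)} {M₀ κ : ℝ} {X P : ℝ → ℝ³} {β : ℝ → ℝ³ → ℂ}

lemma pair_deriv (hs : IsBModelSolution W M₀ κ X P β) (g : 𝓢(ℝ³, ℂ)) (T t : ℝ) (hT : 0 < T)
    (ht : t ∈ Set.Icc 0 T) (a : ℝ³) (s : ℝ) (hs0 : s ∈ Set.Ioo 0 (T + 1)) :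
    HasDerivAt (fun s => ∫ x, β s (x + a) * schU (t - s) g x)
      (-Complex.I * κ * ∫ x, (W (x + a - X s) : ℂ) * schU (t - s) g x) s := by
  obtain ⟨C, hC⟩ := hs.loc_bdd (T + 1) (by linarith)
  have hC0 : 0 ≤ C := (norm_nonneg _).trans (hC 0 ⟨le_rfl, by linarith⟩ 0).1
  obtain ⟨C1, hC1, h1⟩ := schU_decay (T + 1) (by linarith) g
  obtain ⟨C2, hC2, h2⟩ := schLap_decay (T + 1) (by linarith) g
  obtain ⟨CW, hCW, hW⟩ := schwartz_bdd W
  have habs : ∀ r ∈ Set.Ioo 0 (T + 1), |t - r| ≤ T + 1 := by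
    intro r hr; rw [abs_le]; constructor <;> linarith [hr.1, hr.2, ht.1, ht.2]
  have hIcc : ∀ r ∈ Set.Ioo 0 (T + 1), r ∈ Set.Icc 0 (T + 1) := fun r hr => ⟨hr.1.le, hr.2.le⟩
  have hadd : Continuous (fun x : ℝ³ => x + a) := by fun_prop
  have hcβ : ∀ r, 0 ≤ r → Continuous (fun x => β r (x + a)) := fun r hr =>
    (hs.smooth_x r hr).continuous.comp hadd
  have hcl : Continuous (fun x => laplacianR3 (β s) (x + a)) :=
    (lap_cont _ (hs.smooth_x s hs0.1.le)).comp hadd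
  have hcW : Continuous (fun x : ℝ³ => (W (x + a - X s) : ℂ)) :=
    Complex.continuous_ofReal.comp (W.continuous.comp (by fun_prop))
  have hlapb : ∀ r ∈ Set.Ioo 0 (T + 1), ∀ x, ‖laplacianR3 (β r) x‖ ≤ 3 * C := fun r hr x =>
    lap_bound _ (hs.smooth_x r hr.1.le) C x (hC r (hIcc r hr) x).2.2
  have main := (hasDerivAt_integral_of_dominated_loc_of_deriv_le (s := Set.Ioo 0 (T + 1))
    (μ := volume) (x₀ := s)
    (bound := fun x : ℝ³ => ((1 / 2) * (3 * C) + |κ| * CW) * (C1 * rho x) + C * ((1 / 2) * (C2 * rho x)))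
    (F := fun (s : ℝ) (x : ℝ³) => β s (x + a) * schU (t - s) g x)
    (F' := fun (s : ℝ) (x : ℝ³) =>
      (-Complex.I * (-(1 / 2 : ℂ) * laplacianR3 (β s) (x + a) + (κ : ℂ) * (W (x + a - X s) : ℂ)))
        * schU (t - s) g x + β s (x + a) * (-(Complex.I / 2 * schLap (t - s) g x)))
    (Ioo_mem_nhds hs0.1 hs0.2) ?_ ?_ ?_ ?_ ?_ ?_).2
  · refine main.congr_deriv ?_
    have i1 : Integrable (fun x => laplacianR3 (β s) (x + a) * schU (t - s) g x) :=
      bdd_mul_schwartz hcl (fun x => hlapb s hs0 _) _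
    have i2 : Integrable (fun x => (W (x + a - X s) : ℂ) * schU (t - s) g x) :=
      bdd_mul_schwartz hcW (C := CW) (fun x => by rw [Complex.norm_real]; exact hW _) _
    have e : ∫ x, laplacianR3 (β s) (x + a) * schU (t - s) g x =
        ∫ x, β s (x + a) * schLap (t - s) g x := by
      rw [ibp_lap _ (hs.smooth_x s hs0.1.le) C (hC s (hIcc s hs0))]
      simp only [schU_lineDeriv, schLap]
    have i3 : Integrable (fun x => β s (x + a) * schLap (t - s) g x) := by
      simp only [schLap, Finset.mul_sum]
      exact integrable_finsetSum _ fun i _ => bdd_mul_schwartz (hcβ s hs0.1.le)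
        (fun x => (hC s (hIcc s hs0) _).1) _
    calc _ = ∫ x, ((Complex.I / 2) * (laplacianR3 (β s) (x + a) * schU (t - s) g x)
          + (-Complex.I * κ) * ((W (x + a - X s) : ℂ) * schU (t - s) g x))
          - (Complex.I / 2) * (β s (x + a) * schLap (t - s) g x) := by
            congr 1; funext x; ring
      _ = _ := by
        have i12 : Integrable (fun x => (Complex.I / 2) * (laplacianR3 (β s) (x + a) * schU (t - s) g x)
          + (-Complex.I * κ) * ((W (x + a - X s) : ℂ) * schU (t - s) g x)) :=
          (i1.const_mul _).add (i2.const_mul _)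
        rw [integral_sub i12 (i3.const_mul _),
          integral_add (i1.const_mul _) (i2.const_mul _), integral_const_mul, integral_const_mul,
          integral_const_mul, e]
        ring
  · filter_upwards [Ioo_mem_nhds hs0.1 hs0.2] with r hr
    exact ((hcβ r hr.1.le).mul (schU (t - r) g).continuous).aestronglyMeasurable
  · exact bdd_mul_schwartz (hcβ s hs0.1.le) (fun x => (hC s (hIcc s hs0) _).1) _
  · apply Continuous.aestronglyMeasurable
    have c1 := schLap_cont (t - s) g
    have c2 := (schU (t - s) g).continuous
    have c3 := hcβ s hs0.1.le
    exact ((continuous_const.mul ((continuous_const.mul hcl).add (continuous_const.mul hcW))).mul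
      c2).add (c3.mul (continuous_const.mul c1).neg)
  · filter_upwards with x r hr
    refine (norm_add_le _ _).trans (add_le_add ?_ ?_)
    · rw [norm_mul]
      refine mul_le_mul ?_ (h1 _ (habs r hr) x) (norm_nonneg _) (by positivity)
      rw [norm_mul, norm_neg, Complex.norm_I, one_mul]
      refine (norm_add_le _ _).trans (add_le_add ?_ ?_)
      · rw [norm_mul]
        refine mul_le_mul (by simp) (hlapb r hr _) (norm_nonneg _) (by positivity)
      · rw [norm_mul, Complex.norm_real, Complex.norm_real, Real.norm_eq_abs]
        exact mul_le_mul_of_nonneg_left (hW _) (abs_nonneg _)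
    · rw [norm_mul]
      refine mul_le_mul (hC r (hIcc r hr) _).1 ?_ (norm_nonneg _) hC0
      rw [norm_neg, norm_mul]
      exact mul_le_mul (by simp) (h2 _ (habs r hr) x) (norm_nonneg _) (by positivity)
  · exact ((rho_integrable.const_mul _).const_mul _).add
      (((rho_integrable.const_mul _).const_mul _).const_mul _)
  · filter_upwards with x r hr
    have d1 := hs.eqβ r hr.1.le (x + a)
    have d2 : HasDerivAt (fun r => schU (t - r) g x) (-(Complex.I / 2 * schLap (t - r) g x)) r := by
      have := (schU_hasDerivAt (t - r) g x).scomp r ((hasDerivAt_id r).const_sub t)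
      simpa [schLap, Function.comp_def] using this
    exact d1.mul d2

lemma pair_cont (hs : IsBModelSolution W M₀ κ X P β) (g : 𝓢(ℝ³, ℂ)) (T t : ℝ) (hT : 0 < T)
    (ht : t ∈ Set.Icc 0 T) (a : ℝ³) :
    ContinuousOn (fun s => ∫ x, β s (x + a) * schU (t - s) g x) (Set.Icc 0 T) := by
  obtain ⟨C, hC⟩ := hs.loc_bdd T hT
  have hC0 : 0 ≤ C := (norm_nonneg _).trans (hC 0 ⟨le_rfl, by linarith⟩ 0).1
  obtain ⟨C1, hC1, h1⟩ := schU_decay T hT.le g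
  refine continuousOn_of_dominated (bound := fun x => C * (C1 * rho x)) ?_ ?_ ?_ ?_
  · intro s hs0
    exact (((hs.smooth_x s hs0.1).continuous.comp (by fun_prop)).mul
      (schU (t - s) g).continuous).aestronglyMeasurable
  · intro s hs0
    filter_upwards with x
    rw [norm_mul]
    refine mul_le_mul (hC s hs0 _).1 (h1 _ ?_ x) (norm_nonneg _) hC0
    rw [abs_le]; constructor <;> linarith [hs0.1, hs0.2, ht.1, ht.2]
  · exact (rho_integrable.const_mul _).const_mul _
  · filter_upwards with x s hs0
    have d1 := (hs.eqβ s hs0.1 (x + a)).continuousAt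
    have d2 : ContinuousAt (fun r => schU (t - r) g x) s :=
      ContinuousAt.comp (f := fun r => t - r) (g := fun τ => schU τ g x)
        (schU_hasDerivAt (t - s) g x).continuousAt (by fun_prop)
    exact (d1.mul d2).continuousWithinAt

lemma W_pair (hWsym : ∀ x y : ℝ³, ‖x‖ = ‖y‖ → W x = W y) (φ : 𝓢(ℝ³, ℂ))
    (hφ : ∀ x, φ (-x) = - φ x) {L C1 : ℝ} (hL0 : 0 ≤ L)
    (hL : ∀ x y, ‖W x - W y‖ ≤ L * ‖x - y‖) (hb : ∀ x, ‖φ x‖ ≤ C1 * rho x) (v : ℝ³) :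
    ‖∫ x, (W (x + v) : ℂ) * φ x‖ ≤ L * ‖v‖ * (C1 * ∫ x, rho x) := by
  obtain ⟨CW, hCW, hW⟩ := schwartz_bdd W
  have hz : ∫ x, (W x : ℂ) * φ x = 0 := by
    have h : ∫ x, (W x : ℂ) * φ x = - ∫ x, (W x : ℂ) * φ x := by
      conv_lhs => rw [← integral_neg_eq_self]
      rw [← integral_neg]
      congr 1; funext x
      rw [hφ, hWsym (-x) x (norm_neg x)]; ring
    exact self_eq_neg.1 h
  have hi : ∀ v : ℝ³, Integrable (fun x => (W (x + v) : ℂ) * φ x) := by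
    intro v
    have hc : Continuous (fun x : ℝ³ => (W (x + v) : ℂ)) :=
      Complex.continuous_ofReal.comp (W.continuous.comp (by fun_prop))
    exact bdd_mul_schwartz (C := CW) hc (fun x => by rw [Complex.norm_real]; exact hW _) _
  have hi0 : Integrable (fun x => (W x : ℂ) * φ x) := by simpa using hi 0
  have e : ∫ x, (W (x + v) : ℂ) * φ x = ∫ x, ((W (x + v) : ℂ) * φ x - (W x : ℂ) * φ x) := by
    rw [integral_sub (hi v) hi0, hz, sub_zero]
  rw [e, ← integral_const_mul, ← integral_const_mul]
  refine norm_integral_le_of_norm_le ((rho_integrable.const_mul _).const_mul _) ?_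
  filter_upwards with x
  rw [← sub_mul, norm_mul, ← Complex.ofReal_sub, Complex.norm_real]
  refine mul_le_mul ?_ (hb x) (norm_nonneg _) (by positivity)
  simpa using hL (x + v) x

end duality

lemma force_bound (W : 𝓢(ℝ³, ℝ)) (hWsym : ∀ x y : ℝ³, ‖x‖ = ‖y‖ → W x = W y) (κ : ℝ)
    (g : 𝓢(ℝ³, ℂ)) (hg : ∀ x, g (-x) = - g x) (T : ℝ) (hT : 0 < T) :
    ∃ K : ℝ, 0 ≤ K ∧ ∀ (M₀ : ℝ) (X P : ℝ → ℝ³) (β : ℝ → ℝ³ → ℂ), IsBModelSolution W M₀ κ X P β →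
      ∀ (ε D t : ℝ), 0 ≤ ε → 0 ≤ D → t ∈ Set.Icc 0 T → eLpNorm (β 0) 2 volume ≤ ENNReal.ofReal ε →
      (∀ s ∈ Set.Icc 0 t, ‖X t - X s‖ ≤ D) →
      ‖∫ x, β t (x + X t) * g x‖ ≤ K * (ε + D) := by
  obtain ⟨C1, hC1, h1⟩ := schU_decay T hT.le g
  obtain ⟨L, hL0, hL⟩ := schwartz_lip W
  have hR : 0 ≤ ∫ x, rho x := integral_nonneg fun x => (rho_pos x).le
  set K1 := C1 * (eLpNorm rho 2 volume).toReal with hK1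
  set K2 := |κ| * (L * (C1 * ∫ x, rho x)) with hK2
  have hK10 : 0 ≤ K1 := by positivity
  have hK20 : 0 ≤ K2 := by positivity
  refine ⟨K1 + K2 * T, by positivity, ?_⟩
  intro M₀ X P β hs ε D t hε hD ht hβ hX
  have habs : ∀ s ∈ Set.Icc 0 t, |t - s| ≤ T := by
    intro s hs; rw [abs_le]; constructor <;> linarith [hs.1, hs.2, ht.1, ht.2]
  set G : ℝ → ℂ := fun s => ∫ x, β s (x + X t) * schU (t - s) g x with hG
  have hGt : ∫ x, β t (x + X t) * g x = G t := by simp [hG, schU_zero]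
  have hG0 : ‖G 0‖ ≤ ε * K1 :=
    cs_bound hε hC1 (β 0) _ (hs.smooth_x 0 le_rfl).continuous (X t) (schU (t - 0) g).continuous hβ
      (h1 _ (habs 0 ⟨le_rfl, ht.1⟩))
  have hcont : ContinuousOn G (Set.Icc 0 t) :=
    (pair_cont hs g T t hT ht (X t)).mono (Set.Icc_subset_Icc_right ht.2)
  have hder : ∀ s ∈ Set.Ioc 0 t, ‖G t - G s‖ ≤ K2 * D * (t - s) := by
    intro s hs1
    refine norm_image_sub_le_of_norm_deriv_le_segment' (f := G)
      (f' := fun r => -Complex.I * κ * ∫ x, (W (x + X t - X r) : ℂ) * schU (t - r) g x)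
      (a := s) (b := t) ?_ ?_ t ⟨hs1.2, le_rfl⟩
    · intro r hr
      exact (pair_deriv hs g T t hT ht (X t) r
        ⟨hs1.1.trans_le hr.1, by linarith [hr.2, ht.2]⟩).hasDerivWithinAt
    · intro r hr
      have hr' : r ∈ Set.Icc 0 t := ⟨hs1.1.le.trans hr.1, hr.2.le⟩
      have h := W_pair hWsym (schU (t - r) g) (schU_odd _ g hg) hL0 hL (h1 _ (habs r hr')) (X t - X r)
      simp_rw [← add_sub_assoc] at h
      rw [norm_mul, norm_mul, norm_neg, Complex.norm_I, one_mul, Complex.norm_real, Real.norm_eq_abs]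
      refine (mul_le_mul_of_nonneg_left h (abs_nonneg _)).trans ?_
      have : |κ| * (L * ‖X t - X r‖ * (C1 * ∫ x, rho x)) = K2 * ‖X t - X r‖ := by rw [hK2]; ring
      rw [this]
      exact mul_le_mul_of_nonneg_left (hX r hr') hK20
  have hder0 : ‖G t - G 0‖ ≤ K2 * D * T := by
    rcases ht.1.eq_or_lt with h0 | h0
    · rw [← h0]; simp; positivity
    have hc : ContinuousWithinAt G (Set.Ioc 0 t) 0 :=
      (hcont 0 ⟨le_rfl, ht.1⟩).mono Set.Ioc_subset_Icc_self
    have hne : (nhdsWithin (0 : ℝ) (Set.Ioc 0 t)).NeBot := by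
      rw [nhdsWithin_Ioc_eq_nhdsGT h0]; infer_instance
    refine le_of_tendsto ((tendsto_const_nhds.sub hc.tendsto).norm) ?_
    filter_upwards [self_mem_nhdsWithin] with s hs1
    refine (hder s hs1).trans ?_
    exact mul_le_mul_of_nonneg_left (by linarith [hs1.1, ht.2]) (by positivity)
  rw [hGt]
  have : ‖G t‖ ≤ ‖G t - G 0‖ + ‖G 0‖ := by simpa using norm_add_le (G t - G 0) (G 0)
  have h7 : 0 ≤ K1 * D := by positivity
  have h8 : 0 ≤ K2 * T * ε := by positivity
  nlinarith

lemma W_deriv (W : 𝓢(ℝ³, ℝ)) (hWsym : ∀ x y : ℝ³, ‖x‖ = ‖y‖ → W x = W y) (j : Fin 3) :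
    ∃ g : 𝓢(ℝ³, ℂ), (∀ x, g (-x) = - g x) ∧
      ∀ x, g x = ((gradient (W : ℝ³ → ℝ) x j : ℝ) : ℂ) := by
  have hgr : ∀ x, gradient (W : ℝ³ → ℝ) x j =
      fderiv ℝ (W : ℝ³ → ℝ) x (EuclideanSpace.single j (1 : ℝ)) := by
    intro x
    rw [← inner_gradient_left, EuclideanSpace.inner_single_right]
    simp
  have hodd : ∀ x, fderiv ℝ (W : ℝ³ → ℝ) (-x) (EuclideanSpace.single j (1 : ℝ)) =
      - fderiv ℝ (W : ℝ³ → ℝ) x (EuclideanSpace.single j (1 : ℝ)) := by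
    intro x
    have h : (fun y : ℝ³ => W (-y)) = W := funext fun y => hWsym _ _ (norm_neg y)
    have h2 : HasFDerivAt (fun y : ℝ³ => W (-y))
        ((fderiv ℝ (W : ℝ³ → ℝ) (-x)).comp (-(ContinuousLinearMap.id ℝ ℝ³))) x :=
      HasFDerivAt.comp x (W.differentiableAt (x := -x)).hasFDerivAt (hasFDerivAt_id x).neg
    rw [h] at h2
    rw [h2.fderiv]; simp
  have hg : ∀ x, (SchwartzMap.postcompCLM (𝕜 := ℝ) Complex.ofRealCLM
      (∂_{(EuclideanSpace.single j (1 : ℝ) : ℝ³)} W) : 𝓢(ℝ³, ℂ)) x =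
      ((gradient (W : ℝ³ → ℝ) x j : ℝ) : ℂ) := by
    intro x
    rw [SchwartzMap.postcompCLM_apply, hgr, lineDerivOp_apply_eq_fderiv]; rfl
  refine ⟨_, ?_, hg⟩
  intro x
  rw [hg, hg, hgr, hgr, hodd]; push_cast; rfl

lemma total_force (W : 𝓢(ℝ³, ℝ)) (hWsym : ∀ x y : ℝ³, ‖x‖ = ‖y‖ → W x = W y) (κ : ℝ)
    (T : ℝ) (hT : 0 < T) :
    ∃ K : ℝ, 0 ≤ K ∧ ∀ (M₀ : ℝ) (X P : ℝ → ℝ³) (β : ℝ → ℝ³ → ℂ), IsBModelSolution W M₀ κ X P β →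
      ∀ (ε D t : ℝ), 0 ≤ ε → 0 ≤ D → t ∈ Set.Icc 0 T → eLpNorm (β 0) 2 volume ≤ ENNReal.ofReal ε →
      (∀ s ∈ Set.Icc 0 t, ‖X t - X s‖ ≤ D) →
      ‖∫ x : ℝ³, (β t x).re • gradient (W : ℝ³ → ℝ) (x - X t)‖ ≤ K * (ε + D) := by
  choose g hodd hg using W_deriv W hWsym
  choose K hK0 hK using fun j => force_bound W hWsym κ (g j) (hodd j) T hT
  have h00 := hK0 0
  have h01 := hK0 1
  have h02 := hK0 2
  refine ⟨K 0 + K 1 + K 2, by positivity, ?_⟩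
  intro M₀ X P β hs ε D t hε hD ht hβ hX
  by_cases hint : Integrable (fun x : ℝ³ => (β t x).re • gradient (W : ℝ³ → ℝ) (x - X t))
  swap
  · rw [integral_undef hint, norm_zero]; positivity
  obtain ⟨C, hC⟩ := hs.loc_bdd T hT
  have hc : Continuous (fun x => β t (x + X t)) :=
    (hs.smooth_x t ht.1).continuous.comp (by fun_prop)
  have key : ∀ j, |(∫ x : ℝ³, (β t x).re • gradient (W : ℝ³ → ℝ) (x - X t)) j| ≤ K j * (ε + D) := by
    intro j
    have h1 := (EuclideanSpace.proj j : ℝ³ →L[ℝ] ℝ).integral_comp_comm hint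
    have h2 : (∫ x : ℝ³, (β t x).re • gradient (W : ℝ³ → ℝ) (x - X t)) j =
        ∫ x : ℝ³, (β t x).re * gradient (W : ℝ³ → ℝ) (x - X t) j := h1.symm
    have h3 : ∫ x : ℝ³, (β t x).re * gradient (W : ℝ³ → ℝ) (x - X t) j =
        ∫ x : ℝ³, (β t (x + X t)).re * gradient (W : ℝ³ → ℝ) x j := by
      rw [← integral_add_right_eq_self _ (X t)]
      simp only [add_sub_cancel_right]
    have hi : Integrable (fun x => β t (x + X t) * g j x) :=
      bdd_mul_schwartz hc (fun x => (hC t ht _).1) _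
    have h4 : ∫ x : ℝ³, (β t (x + X t)).re * gradient (W : ℝ³ → ℝ) x j =
        (∫ x, β t (x + X t) * g j x).re := by
      have := Complex.reCLM.integral_comp_comm hi
      rw [Complex.reCLM_apply] at this
      rw [← this]
      congr 1; funext x
      rw [Complex.reCLM_apply, hg, Complex.re_mul_ofReal]
    rw [h2, h3, h4]
    exact (Complex.abs_re_le_norm _).trans (hK j M₀ X P β hs ε D t hε hD ht hβ hX)
  have h := norm_le_sum_coord (∫ x : ℝ³, (β t x).re • gradient (W : ℝ³ → ℝ) (x - X t))
  linarith [key 0, key 1, key 2]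

lemma gronwall_P {W : 𝓢(ℝ³, ℝ)} {M₀ κ : ℝ} (hM₀ : 0 < M₀) {X P : ℝ → ℝ³} {β : ℝ → ℝ³ → ℂ}
    (hs : IsBModelSolution W M₀ κ X P β) {T K ε : ℝ} (hT : 0 < T) (hK : 0 ≤ K) (hε : 0 ≤ ε)
    (hP0 : ‖P 0‖ ≤ ε)
    (hF : ∀ (D t : ℝ), 0 ≤ D → t ∈ Set.Icc 0 T → (∀ s ∈ Set.Icc 0 t, ‖X t - X s‖ ≤ D) →
      ‖(2 * κ) • ∫ x : ℝ³, (β t x).re • gradient (W : ℝ³ → ℝ) (x - X t)‖ ≤ K * (ε + D)) :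
    ∀ t ∈ Set.Icc 0 T, ‖P t‖ ≤ 2 * (1 + K * T) * ε * Real.exp ((2 * K * T / M₀ + 1) * T) := by
  set l := 2 * K * T / M₀ + 1 with hl
  have hl0 : 0 < l := by positivity
  have hPc : ContinuousOn P (Set.Icc 0 T) := fun t ht => (hs.eqP t ht.1).continuousAt.continuousWithinAt
  obtain ⟨s0, hs0, hmax⟩ := isCompact_Icc.exists_isMaxOn (Set.nonempty_Icc.2 hT.le)
    (f := fun s => Real.exp (-(l * s)) * ‖P s‖) (by fun_prop)
  set M := Real.exp (-(l * s0)) * ‖P s0‖ with hM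
  have hM0 : 0 ≤ M := by positivity
  have hPM : ∀ s ∈ Set.Icc 0 T, ‖P s‖ ≤ M * Real.exp (l * s) := by
    intro s hs'
    have h : Real.exp (-(l * s)) * ‖P s‖ ≤ M := hmax hs'
    have h2 := mul_le_mul_of_nonneg_right h (Real.exp_pos (l * s)).le
    rw [mul_right_comm, ← Real.exp_add] at h2
    simpa using h2
  have hXD : ∀ t ∈ Set.Icc 0 T, ∀ s ∈ Set.Icc 0 t, ‖X t - X s‖ ≤ T * (M₀⁻¹ * (M * Real.exp (l * t))) := by
    intro t ht s hst
    have h := (convex_Icc 0 t).norm_image_sub_le_of_norm_hasDerivWithin_le (f := X)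
      (f' := fun r => M₀⁻¹ • P r) (C := M₀⁻¹ * (M * Real.exp (l * t)))
      (fun r hr => (hs.eqX r hr.1).hasDerivWithinAt) (fun r hr => by
        rw [norm_smul, Real.norm_of_nonneg (by positivity)]
        refine mul_le_mul_of_nonneg_left ((hPM r ⟨hr.1, hr.2.trans ht.2⟩).trans ?_) (by positivity)
        exact mul_le_mul_of_nonneg_left (Real.exp_le_exp.2 (mul_le_mul_of_nonneg_left hr.2 hl0.le)) hM0)
      hst (⟨ht.1, le_rfl⟩ : t ∈ Set.Icc 0 t)
    refine h.trans ?_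
    rw [mul_comm T]
    refine mul_le_mul_of_nonneg_left ?_ (by positivity)
    rw [Real.norm_of_nonneg (by linarith [hst.2])]
    linarith [hst.1, ht.2]
  have hB : ∀ x, HasDerivAt (fun t => ε + K * ε * t + (K * T * M / (M₀ * l)) * Real.exp (l * t))
      (K * (ε + T * (M₀⁻¹ * (M * Real.exp (l * x))))) x := by
    intro x
    have h1 : HasDerivAt (fun t => Real.exp (l * t)) (Real.exp (l * x) * (l * 1)) x :=
      ((hasDerivAt_id x).const_mul l).exp
    have h2 := (((hasDerivAt_id x).const_mul (K * ε)).const_add ε).add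
      (h1.const_mul (K * T * M / (M₀ * l)))
    refine h2.congr_deriv ?_
    field_simp
  have hmain : ∀ t ∈ Set.Icc 0 T,
      ‖P t‖ ≤ ε + K * ε * t + (K * T * M / (M₀ * l)) * Real.exp (l * t) := by
    intro t ht
    refine image_norm_le_of_norm_deriv_right_le_deriv_boundary (a := 0) (b := T) hPc
      (fun x hx => (hs.eqP x hx.1).hasDerivWithinAt) ?_ hB (fun x hx => ?_) ht
    · have : 0 ≤ (K * T * M / (M₀ * l)) * Real.exp (l * 0) := by positivity
      linarith
    · exact hF _ x (by positivity) ⟨hx.1, hx.2.le⟩ (hXD x ⟨hx.1, hx.2.le⟩)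
  have hhalf : K * T * M / (M₀ * l) ≤ M / 2 := by
    rw [div_le_div_iff₀ (by positivity) (by norm_num)]
    have : M₀ * l = 2 * K * T + M₀ := by rw [hl]; field_simp
    rw [this]
    nlinarith [mul_nonneg hM0 hM₀.le]
  have hMle : M ≤ 2 * (1 + K * T) * ε := by
    have h1 := hmain s0 hs0
    have h2 : ‖P s0‖ = M * Real.exp (l * s0) := by
      rw [hM, mul_right_comm, ← Real.exp_add]; simp
    rw [h2] at h1
    have h3 := mul_le_mul_of_nonneg_right hhalf (Real.exp_pos (l * s0)).le
    have h4 : (1 : ℝ) ≤ Real.exp (l * s0) := Real.one_le_exp (mul_nonneg hl0.le hs0.1)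
    have h5 : K * ε * s0 ≤ K * ε * T := mul_le_mul_of_nonneg_left hs0.2 (by positivity)
    have h6 : M / 2 * 1 ≤ M / 2 * Real.exp (l * s0) := mul_le_mul_of_nonneg_left h4 (by positivity)
    linarith
  intro t ht
  refine (hPM t ht).trans ?_
  exact mul_le_mul hMle (Real.exp_le_exp.2 (mul_le_mul_of_nonneg_left ht.2 hl0.le))
    (Real.exp_pos _).le (by positivity)

lemma jbracket_eLp (b : ℝ³ → ℂ) :
    eLpNorm b 2 volume ≤ eLpNorm (fun x : ℝ³ => (jbracket x) ^ 3 • b x) 2 volume := by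
  refine eLpNorm_mono fun x => ?_
  have h : 1 ≤ jbracket x := by
    rw [jbracket, Real.one_le_sqrt]; nlinarith [sq_nonneg ‖x‖]
  rw [norm_smul, norm_pow, Real.norm_of_nonneg (by linarith)]
  exact le_mul_of_one_le_left (norm_nonneg _) (one_le_pow₀ h)

/-- For every `T > 0` there exists `ε = ε(T) > 0` such that every B-model solution with
`‖⟨x⟩³ β₀‖_{L²} ≤ ε` and `‖P 0‖ ≤ ε` satisfies `‖P t‖ ≤ T⁻²` for all `t ∈ [0, T]`. -/
theorem bmodel_small_momentum_on_finite_interval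
    (W : 𝓢(ℝ³, ℝ)) (hWsym : ∀ x y : ℝ³, ‖x‖ = ‖y‖ → W x = W y)
    (hWint : (∫ x : ℝ³, W x) ≠ 0)
    (M₀ κ : ℝ) (hM₀ : 0 < M₀) (hκ : 0 < κ) :
    ∀ T > (0 : ℝ), ∃ ε > (0 : ℝ),
      ∀ (X P : ℝ → ℝ³) (β : ℝ → ℝ³ → ℂ),
        IsBModelSolution W M₀ κ X P β →
        eLpNorm (fun x : ℝ³ => (jbracket x) ^ 3 • β 0 x) 2 volume ≤ ENNReal.ofReal ε →
        ‖P 0‖ ≤ ε →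
        ∀ t ∈ Set.Icc (0 : ℝ) T, ‖P t‖ ≤ T ^ (-2 : ℤ) := by
  intro T hT
  obtain ⟨K, hK0, hK⟩ := total_force W hWsym κ T hT
  set K' := 2 * κ * K with hK'
  have hK'0 : 0 ≤ K' := by positivity
  have hden : 0 < 2 * (1 + K' * T) * Real.exp ((2 * K' * T / M₀ + 1) * T) := by positivity
  set ε := T ^ (-2 : ℤ) / (2 * (1 + K' * T) * Real.exp ((2 * K' * T / M₀ + 1) * T)) with hε
  have hε0 : 0 < ε := by positivity
  refine ⟨ε, hε0, ?_⟩
  intro X P β hs hβ hP t ht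
  refine (gronwall_P hM₀ hs hT hK'0 hε0.le hP ?_ t ht).trans ?_
  · intro D r hD hr hX
    rw [norm_smul, Real.norm_of_nonneg (by positivity), hK', mul_assoc (2 * κ)]
    exact mul_le_mul_of_nonneg_left
      (hK M₀ X P β hs ε D r hε0.le hD hr ((jbracket_eLp _).trans hβ) hX) (by positivity)
  · rw [mul_right_comm, mul_comm, hε, div_mul_cancel₀ _ hden.ne']
end
end

section
/- Let g : ℝ³ → ℂ be a Schwartz function. There exists a constant C > 0 such that for all t ≥ 1: | ∫_{ℝ³} g(k) e^{−i‖k‖² t/2} dk − (2π)^{3/2} e^{−3πi/4} t^{−3/2} g(0) | ≤ C t^{−5/2}. -/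
open MeasureTheory Filter Real SchwartzMap

noncomputable section

local notation "ℝ³" => EuclideanSpace ℝ (Fin 3)

open scoped FourierTransform Topology

lemma aux_pos (g : 𝓢(ℝ³, ℂ)) (b : ℂ) (hb : 0 < b.re) :
    ∫ k : ℝ³, g k * Complex.exp (-b * (‖k‖ : ℂ) ^ 2) =
      (π / b) ^ ((3 : ℂ) / 2) *
        ∫ w : ℝ³, (𝓕⁻ g) w * Complex.exp (-π ^ 2 * (‖w‖ : ℂ) ^ 2 / b) := by
  have hint : Integrable (fun k : ℝ³ => Complex.exp (-b * (‖k‖ : ℂ) ^ 2)) := by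
    simpa using GaussianFourier.integrable_cexp_neg_mul_sq_norm_add hb 0 (0 : ℝ³)
  have h1 := VectorFourier.integral_fourierIntegral_smul_eq_flip (L := innerₗ ℝ³)
      (μ := volume) (ν := volume)
      Real.continuous_fourierChar continuous_inner (𝓕⁻ g).integrable hint
  have h2 : (VectorFourier.fourierIntegral 𝐞 volume (innerₗ ℝ³) (𝓕⁻ g : 𝓢(ℝ³, ℂ))) = g := by
    have : (𝓕 (𝓕⁻ g) : 𝓢(ℝ³, ℂ)) = g := FourierTransform.fourier_fourierInv_eq g
    exact congrArg (fun f : 𝓢(ℝ³, ℂ) => (f : ℝ³ → ℂ)) this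
  have h3 : ∀ w, (VectorFourier.fourierIntegral 𝐞 volume (innerₗ ℝ³).flip
      (fun k : ℝ³ => Complex.exp (-b * (‖k‖ : ℂ) ^ 2))) w =
      (π / b) ^ ((3 : ℂ) / 2) * Complex.exp (-π ^ 2 * (‖w‖ : ℂ) ^ 2 / b) := by
    intro w
    have := fourier_gaussian_innerProductSpace hb w
    simp only [finrank_euclideanSpace, Fintype.card_fin, Nat.cast_ofNat] at this
    rw [flip_innerₗ]
    exact this
  rw [h2] at h1
  simp only [h3, smul_eq_mul] at h1
  rw [h1, ← integral_const_mul]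
  congr 1; ext w; ring

lemma tends_aux (f : 𝓢(ℝ³, ℂ)) (c : ℝ → ℂ) (c0 : ℂ) (hc : Tendsto c (𝓝[>] 0) (𝓝 c0))
    (hre : ∀ᶠ ε in 𝓝[>] (0 : ℝ), 0 ≤ (c ε).re) :
    Tendsto (fun ε => ∫ k : ℝ³, f k * Complex.exp (-((‖k‖ ^ 2 : ℝ) : ℂ) * c ε)) (𝓝[>] 0)
      (𝓝 (∫ k : ℝ³, f k * Complex.exp (-((‖k‖ ^ 2 : ℝ) : ℂ) * c0))) := by
  apply tendsto_integral_filter_of_dominated_convergence (fun k => ‖f k‖)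
  · refine Eventually.of_forall fun ε => Continuous.aestronglyMeasurable ?_
    have := f.continuous
    fun_prop
  · filter_upwards [hre] with ε hε
    refine Eventually.of_forall fun k => ?_
    rw [norm_mul, Complex.norm_exp]
    refine mul_le_of_le_one_right (norm_nonneg _) (Real.exp_le_one_iff.2 ?_)
    rw [← Complex.ofReal_neg, Complex.re_ofReal_mul]
    have : 0 ≤ ‖k‖ ^ 2 * (c ε).re := by positivity
    linarith
  · exact f.integrable.norm
  · refine Eventually.of_forall fun k => ?_
    exact ((hc.const_mul _).cexp).const_mul _

lemma aux_zero (g : 𝓢(ℝ³, ℂ)) (b : ℂ) (hb : b.re = 0) (hb' : b.im ≠ 0) :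
    ∫ k : ℝ³, g k * Complex.exp (-((‖k‖ ^ 2 : ℝ) : ℂ) * b) =
      (π / b) ^ ((3 : ℂ) / 2) *
        ∫ w : ℝ³, (𝓕⁻ g) w * Complex.exp (-((‖w‖ ^ 2 : ℝ) : ℂ) * (π ^ 2 / b)) := by
  have hb0 : b ≠ 0 := fun h => hb' (by simp [h])
  have hc : Tendsto (fun ε : ℝ => b + (ε : ℂ)) (𝓝[>] (0 : ℝ)) (𝓝 b) := by
    have : Continuous (fun ε : ℝ => b + ε) := by fun_prop
    simpa using (this.tendsto 0).mono_left nhdsWithin_le_nhds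
  have hpos : ∀ᶠ ε : ℝ in 𝓝[>] (0 : ℝ), 0 < (b + (ε : ℂ)).re := by
    filter_upwards [self_mem_nhdsWithin] with ε hε
    simpa [hb] using hε
  have t1 := tends_aux g _ b hc (hpos.mono fun _ h => h.le)
  have t2 := tends_aux (𝓕⁻ g) (fun ε : ℝ => π ^ 2 / (b + ε)) (π ^ 2 / b)
    (Tendsto.div tendsto_const_nhds hc hb0) (by
      filter_upwards [hpos] with ε hε
      rw [← Complex.ofReal_pow, div_eq_mul_inv, Complex.re_ofReal_mul, Complex.inv_re]
      have := Complex.normSq_nonneg (b + ε)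
      positivity)
  have t3 : Tendsto (fun ε : ℝ => ((π : ℂ) / (b + ε)) ^ ((3 : ℂ) / 2)) (𝓝[>] 0)
      (𝓝 ((π / b) ^ ((3 : ℂ) / 2))) := by
    refine (Tendsto.div tendsto_const_nhds hc hb0).cpow tendsto_const_nhds ?_
    rw [Complex.mem_slitPlane_iff]
    right
    rw [div_eq_mul_inv, Complex.im_ofReal_mul, Complex.inv_im]
    have := Complex.normSq_pos.2 hb0
    exact mul_ne_zero pi_pos.ne' (div_ne_zero (neg_ne_zero.2 hb') this.ne')
  refine tendsto_nhds_unique_of_eventuallyEq t1 (t3.mul t2) ?_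
  filter_upwards [hpos] with ε hε
  have := aux_pos g _ hε
  convert this using 4 with k
  · congr 1; push_cast; ring
  · congr 1; push_cast; ring

lemma const_aux (t : ℝ) (ht : 0 < t) :
    ((π : ℂ) / (Complex.I * t / 2)) ^ ((3 : ℂ) / 2) =
    (((2 * Real.pi) ^ ((3 : ℝ) / 2) : ℝ) : ℂ) *
            Complex.exp (((-(3 * Real.pi / 4) : ℝ) : ℂ) * Complex.I) *
            ((t ^ (-(3 : ℝ) / 2) : ℝ) : ℂ) := by
  have h : (π : ℂ) / (Complex.I * t / 2) = ((2 * π / t : ℝ) : ℂ) * (-Complex.I) := by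
    have : (t : ℂ) ≠ 0 := by exact_mod_cast ht.ne'
    push_cast
    field_simp
    simp
  have hp : 0 < 2 * π / t := by positivity
  have hne : (((2 * π / t : ℝ) : ℂ) * (-Complex.I)) ≠ 0 :=
    mul_ne_zero (by exact_mod_cast hp.ne') (by simp)
  rw [h, Complex.cpow_def_of_ne_zero hne, Complex.log_ofReal_mul hp (by simp), Complex.log_neg_I,
    Real.log_div (by positivity) ht.ne', Real.rpow_def_of_pos (by positivity),
    Real.rpow_def_of_pos ht, Complex.ofReal_exp, Complex.ofReal_exp, ← Complex.exp_add,
    ← Complex.exp_add]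
  congr 1
  push_cast
  ring

theorem fresnel_integral_asymptotics (g : 𝓢(ℝ³, ℂ)) :
    ∃ C > (0 : ℝ), ∀ t : ℝ, 1 ≤ t →
      ‖(∫ k : ℝ³, g k * Complex.exp (-Complex.I * (‖k‖ : ℂ) ^ 2 * (t : ℂ) / 2)) -
          (((2 * Real.pi) ^ ((3 : ℝ) / 2) : ℝ) : ℂ) *
            Complex.exp (((-(3 * Real.pi / 4) : ℝ) : ℂ) * Complex.I) *
            ((t ^ (-(3 : ℝ) / 2) : ℝ) : ℂ) * g 0‖ ≤ C * t ^ (-(5 : ℝ) / 2) := by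
  set G : 𝓢(ℝ³, ℂ) := 𝓕⁻ g with hG
  set M : ℝ := ∫ w : ℝ³, ‖w‖ ^ 2 * ‖G w‖ with hM
  have hMi : Integrable (fun w : ℝ³ => ‖w‖ ^ 2 * ‖G w‖) := G.integrable_pow_mul volume 2
  have hM0 : 0 ≤ M := integral_nonneg fun w => by positivity
  have hg0 : g 0 = ∫ w : ℝ³, G w := by
    have : (𝓕 G : 𝓢(ℝ³, ℂ)) = g := FourierTransform.fourier_fourierInv_eq g
    rw [← this, SchwartzMap.fourier_coe, Real.fourier_eq]
    simp
  refine ⟨(2 * π) ^ ((3 : ℝ) / 2) * (2 * π ^ 2 * M) + 1, by positivity, fun t ht => ?_⟩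
  have ht0 : 0 < t := by linarith
  have key := aux_zero g (Complex.I * t / 2) (by simp) (by simp [ht0.ne'])
  rw [const_aux t ht0] at key
  have e1 : (∫ k : ℝ³, g k * Complex.exp (-Complex.I * (‖k‖ : ℂ) ^ 2 * (t : ℂ) / 2)) =
      ∫ k : ℝ³, g k * Complex.exp (-((‖k‖ ^ 2 : ℝ) : ℂ) * (Complex.I * t / 2)) := by
    congr 1; ext k; congr 2; push_cast; ring
  rw [e1, key, ← hG, ← mul_sub, hg0]
  have hx : ∀ w : ℝ³, -((‖w‖ ^ 2 : ℝ) : ℂ) * (π ^ 2 / (Complex.I * t / 2)) =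
      Complex.I * ((2 * π ^ 2 / t * ‖w‖ ^ 2 : ℝ) : ℂ) := by
    intro w
    have : (t : ℂ) ≠ 0 := by exact_mod_cast ht0.ne'
    push_cast
    field_simp
    simp
  have hi : Integrable (fun w : ℝ³ =>
      G w * Complex.exp (-((‖w‖ ^ 2 : ℝ) : ℂ) * (π ^ 2 / (Complex.I * t / 2)))) := by
    refine G.integrable.norm.mono' (Continuous.aestronglyMeasurable ?_)
      (Eventually.of_forall fun w => ?_)
    · have := G.continuous
      fun_prop
    · rw [norm_mul, hx, Complex.norm_exp_I_mul_ofReal, mul_one]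
  have hbd : ‖(∫ w : ℝ³, G w * Complex.exp (-((‖w‖ ^ 2 : ℝ) : ℂ) * (π ^ 2 / (Complex.I * t / 2))))
      - ∫ w : ℝ³, G w‖ ≤ 2 * π ^ 2 / t * M := by
    rw [← integral_sub hi G.integrable, hM, ← integral_const_mul]
    refine norm_integral_le_of_norm_le (hMi.const_mul _) (Eventually.of_forall fun w => ?_)
    have h1 := Real.norm_exp_I_mul_ofReal_sub_one_le (x := 2 * π ^ 2 / t * ‖w‖ ^ 2)
    rw [Real.norm_of_nonneg (by positivity)] at h1
    rw [hx]
    calc _ = ‖G w‖ * ‖Complex.exp (Complex.I * ((2 * π ^ 2 / t * ‖w‖ ^ 2 : ℝ) : ℂ)) - 1‖ := by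
          rw [← norm_mul]; congr 1; ring
      _ ≤ ‖G w‖ * (2 * π ^ 2 / t * ‖w‖ ^ 2) := by gcongr
      _ = _ := by ring
  have ht52 : t ^ (-(5 : ℝ) / 2) = t ^ (-(3 : ℝ) / 2) / t := by
    rw [show -(5 : ℝ) / 2 = -(3 : ℝ) / 2 - 1 by norm_num, Real.rpow_sub_one ht0.ne']
  rw [norm_mul, norm_mul, norm_mul, Complex.norm_exp_ofReal_mul_I, Complex.norm_real,
    Complex.norm_real, Real.norm_of_nonneg (by positivity), Real.norm_of_nonneg (by positivity)]
  calc _ ≤ (2 * π) ^ ((3 : ℝ) / 2) * 1 * t ^ (-(3 : ℝ) / 2) * (2 * π ^ 2 / t * M) := by gcongr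
    _ = (2 * π) ^ ((3 : ℝ) / 2) * (2 * π ^ 2 * M) * t ^ (-(5 : ℝ) / 2) := by rw [ht52]; ring
    _ ≤ _ := by gcongr; linarith
end
end

section
/- Let g : ℝ³ → ℝ be a real-valued Schwartz function. There exists a constant C > 0 such that for all t ≥ 1: | Re ∫_{ℝ³} g(k) e^{−i‖k‖² t/2} dk + 2 π^{3/2} t^{−3/2} g(0) | ≤ C t^{−5/2}; that is, Re ∫ g(k) e^{−i‖k‖²t/2} dk = −2π^{3/2} t^{−3/2} g(0) + O(t^{−5/2}) as t → ∞. -/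
open MeasureTheory Filter Real SchwartzMap

noncomputable section

local notation "ℝ³" => EuclideanSpace ℝ (Fin 3)

open scoped FourierTransform Topology

lemma exists_fourier_rep (g : 𝓢(ℝ³, ℝ)) : ∃ h : 𝓢(ℝ³, ℂ), ∀ k, 𝓕 (h : ℝ³ → ℂ) k = (g k : ℂ) := by
  have hc : Function.HasTemperateGrowth (fun _ : ℝ³ => (1 : ℂ)) := by fun_prop
  let G : 𝓢(ℝ³, ℂ) := bilinLeftCLM (ContinuousLinearMap.lsmul ℝ ℝ : ℝ →L[ℝ] ℂ →L[ℝ] ℂ) hc g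
  refine ⟨𝓕⁻ G, fun k => ?_⟩
  rw [← fourier_coe, FourierTransform.fourier_fourierInv_eq]
  change (ContinuousLinearMap.lsmul ℝ ℝ : ℝ →L[ℝ] ℂ →L[ℝ] ℂ) (g k) 1 = _
  simp

lemma gauss_pairing (g : 𝓢(ℝ³, ℝ)) (h : 𝓢(ℝ³, ℂ)) (hh : ∀ k, 𝓕 (h : ℝ³ → ℂ) k = (g k : ℂ))
    {b : ℂ} (hb : 0 < b.re) :
    ∫ k : ℝ³, (g k : ℂ) * Complex.exp (-b * ‖k‖ ^ 2) =
      (π / b) ^ (3 / 2 : ℂ) * ∫ w : ℝ³, h w * Complex.exp (-π ^ 2 * ‖w‖ ^ 2 / b) := by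
  have hI : Integrable (fun v : ℝ³ => Complex.exp (-b * ‖v‖ ^ 2)) := by
    simpa using GaussianFourier.integrable_cexp_neg_mul_sq_norm_add hb 0 (0 : ℝ³)
  have key : ∫ ξ, 𝓕 (h : ℝ³ → ℂ) ξ * Complex.exp (-b * ‖ξ‖ ^ 2) =
      ∫ x, h x * 𝓕 (fun v : ℝ³ => Complex.exp (-b * ‖v‖ ^ 2)) x := by
    simpa using! (VectorFourier.integral_fourierIntegral_smul_eq_flip (L := innerₗ ℝ³)
      Real.continuous_fourierChar continuous_inner (h.integrable (μ := volume)) hI)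
  simp_rw [hh] at key
  rw [key, ← integral_const_mul]
  congr 1 with w
  rw [fourier_gaussian_innerProductSpace hb]
  simp
  ring

lemma gauss_lim {F : ℝ³ → ℂ} (hF : Integrable F) (hFc : Continuous F) {c : ℝ → ℂ} {c0 : ℂ}
    (hc : Tendsto c (𝓝[>] 0) (𝓝 c0)) (hre : ∀ᶠ e in 𝓝[>] 0, 0 ≤ (c e).re) :
    Tendsto (fun e => ∫ k, F k * Complex.exp (-c e * ‖k‖ ^ 2)) (𝓝[>] 0)
      (𝓝 (∫ k, F k * Complex.exp (-c0 * ‖k‖ ^ 2))) := by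
  apply tendsto_integral_filter_of_dominated_convergence (fun k => ‖F k‖)
  · exact Eventually.of_forall fun e => (by fun_prop : Continuous _).aestronglyMeasurable
  · filter_upwards [hre] with e he
    refine Eventually.of_forall fun k => ?_
    rw [norm_mul, Complex.norm_exp]
    refine mul_le_of_le_one_right (norm_nonneg _) (Real.exp_le_one_iff.2 ?_)
    have : (-c e * (‖k‖ : ℂ) ^ 2).re = -((c e).re * ‖k‖ ^ 2) := by
      rw [← Complex.ofReal_pow, Complex.re_mul_ofReal]; simp
    rw [this]
    have := mul_nonneg he (sq_nonneg ‖k‖)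
    linarith
  · exact hF.norm
  · refine Eventually.of_forall fun k => ?_
    exact ((Complex.continuous_exp.tendsto _).comp (hc.neg.mul_const _)).const_mul _

lemma fresnel_pairing (g : 𝓢(ℝ³, ℝ)) (h : 𝓢(ℝ³, ℂ)) (hh : ∀ k, 𝓕 (h : ℝ³ → ℂ) k = (g k : ℂ))
    {t : ℝ} (ht : 0 < t) :
    ∫ k : ℝ³, (g k : ℂ) * Complex.exp (-(Complex.I * t / 2) * ‖k‖ ^ 2) =
      (π / (Complex.I * t / 2)) ^ (3 / 2 : ℂ) *
        ∫ w : ℝ³, h w * Complex.exp (-(π ^ 2 / (Complex.I * t / 2)) * ‖w‖ ^ 2) := by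
  set b0 : ℂ := Complex.I * t / 2 with hb0
  have hb0ne : b0 ≠ 0 := by simp [hb0, ht.ne']
  have hb : Tendsto (fun e : ℝ => b0 + e) (𝓝[>] 0) (𝓝 b0) := by
    have : Continuous (fun e : ℝ => b0 + e) := by fun_prop
    simpa using (this.tendsto 0).mono_left nhdsWithin_le_nhds
  have hre : ∀ e : ℝ, (b0 + e).re = e := by intro e; simp [hb0]
  have hpos : ∀ᶠ e : ℝ in 𝓝[>] 0, 0 < e := self_mem_nhdsWithin
  have hG : Integrable (fun k => (g k : ℂ)) := (g.integrable (μ := volume)).ofReal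
  have L1 := gauss_lim hG (Complex.continuous_ofReal.comp g.continuous) hb
    (by filter_upwards [hpos] with e he; rw [hre]; exact he.le)
  have hb' : Tendsto (fun e : ℝ => (π : ℂ) ^ 2 / (b0 + e)) (𝓝[>] 0) (𝓝 (π ^ 2 / b0)) :=
    tendsto_const_nhds.div hb hb0ne
  have L2 := gauss_lim (h.integrable (μ := volume)) h.continuous hb'
    (by
      filter_upwards [hpos] with e he
      rw [← Complex.ofReal_pow, div_eq_mul_inv, Complex.re_ofReal_mul, Complex.inv_re, hre]
      have := Complex.normSq_nonneg (b0 + e)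
      positivity)
  have hsl : (π : ℂ) / b0 ∈ Complex.slitPlane := by
    right
    have : (π : ℂ) / b0 = ((2 * π / t : ℝ) : ℂ) * -Complex.I := by
      rw [hb0]; push_cast
      have : (t : ℂ) ≠ 0 := by simp [ht.ne']
      field_simp
      simp
    rw [this]
    simp only [Complex.im_ofReal_mul, Complex.neg_im, Complex.I_im]
    have := div_pos two_pi_pos ht
    nlinarith
  have L3 : Tendsto (fun e : ℝ => ((π : ℂ) / (b0 + e)) ^ (3 / 2 : ℂ)) (𝓝[>] 0)
      (𝓝 ((π / b0) ^ (3 / 2 : ℂ))) :=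
    (tendsto_const_nhds.div hb hb0ne).cpow tendsto_const_nhds hsl
  refine tendsto_nhds_unique L1 ((L3.mul L2).congr' ?_)
  filter_upwards [hpos] with e he
  rw [gauss_pairing g h hh (by rw [hre]; exact he)]
  congr 2 with w
  congr 2
  ring

lemma const_eq {t : ℝ} (ht : 0 < t) : ((π : ℂ) / (Complex.I * t / 2)) ^ (3 / 2 : ℂ) =
    ((2 * π / t) ^ (3 / 2 : ℝ) : ℝ) * Complex.exp ((-(3 * π / 4) : ℝ) * Complex.I) := by
  have hr := div_pos two_pi_pos ht
  have : (π : ℂ) / (Complex.I * t / 2) = ((2 * π / t : ℝ) : ℂ) * -Complex.I := by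
    push_cast
    have : (t : ℂ) ≠ 0 := by simp [ht.ne']
    field_simp
    simp
  rw [this, Complex.cpow_def_of_ne_zero (by simp [ht.ne', pi_ne_zero]),
    Complex.log_ofReal_mul hr (by simp), Complex.log_neg_I, Real.rpow_def_of_pos hr,
    Complex.ofReal_exp, ← Complex.exp_add]
  congr 1
  push_cast
  ring

lemma const_re {t : ℝ} (ht : 0 < t) : (((π : ℂ) / (Complex.I * t / 2)) ^ (3 / 2 : ℂ)).re =
    -(2 * π ^ ((3 : ℝ) / 2) * t ^ (-(3 : ℝ) / 2)) := by
  rw [const_eq ht, Complex.re_ofReal_mul, Complex.exp_ofReal_mul_I_re, Real.cos_neg,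
    show 3 * π / 4 = π - π / 4 by ring, Real.cos_pi_sub, Real.cos_pi_div_four,
    Real.div_rpow two_pi_pos.le ht.le, Real.mul_rpow two_pos.le pi_pos.le,
    neg_div, Real.rpow_neg ht.le]
  have : (2 : ℝ) ^ (3 / 2 : ℝ) = 2 * √2 := by
    rw [Real.sqrt_eq_rpow, ← Real.rpow_one_add' two_pos.le (by norm_num)]; norm_num
  rw [this]
  have h2 : √2 * √2 = (2 : ℝ) := Real.mul_self_sqrt two_pos.le
  rw [div_eq_mul_inv]
  linear_combination (-(π ^ (3 / 2 : ℝ) * (t ^ (3 / 2 : ℝ))⁻¹)) * h2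

/-- For a real-valued Schwartz function `g`,
`Re ∫ g(k) e^{-i‖k‖²t/2} dk = -2 π^{3/2} t^{-3/2} g(0) + O(t^{-5/2})` as `t → ∞`. -/
theorem fresnel_integral_real_part_asymptotics (g : 𝓢(ℝ³, ℝ)) :
    ∃ C > (0 : ℝ), ∀ t : ℝ, 1 ≤ t →
      |(∫ k : ℝ³, (g k : ℂ) * Complex.exp (-Complex.I * (‖k‖ : ℂ) ^ 2 * (t : ℂ) / 2)).re +
          2 * Real.pi ^ ((3 : ℝ) / 2) * t ^ (-(3 : ℝ) / 2) * g 0| ≤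
        C * t ^ (-(5 : ℝ) / 2) := by
  obtain ⟨h, hh⟩ := exists_fourier_rep g
  set M : ℝ := ∫ w : ℝ³, ‖w‖ ^ 2 * ‖h w‖ with hM
  have hM0 : 0 ≤ M := integral_nonneg fun w => by positivity
  refine ⟨(2 * π) ^ (3 / 2 : ℝ) * (2 * π ^ 2 * M) + 1, by positivity, fun t ht1 => ?_⟩
  have ht : 0 < t := by linarith
  have e1 : ∫ k : ℝ³, (g k : ℂ) * Complex.exp (-Complex.I * (‖k‖ : ℂ) ^ 2 * (t : ℂ) / 2) =
      ∫ k : ℝ³, (g k : ℂ) * Complex.exp (-(Complex.I * t / 2) * ‖k‖ ^ 2) := by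
    congr 1 with k
    congr 2
    ring
  have hg0 : ∫ w, h w = (g 0 : ℂ) := by
    rw [← hh 0, Real.fourier_eq']; simp
  set A : ℂ := ((π : ℂ) / (Complex.I * t / 2)) ^ (3 / 2 : ℂ) with hA
  set J : ℂ := ∫ w : ℝ³, h w * Complex.exp (-(π ^ 2 / (Complex.I * t / 2)) * ‖w‖ ^ 2) with hJ
  have harg : ∀ w : ℝ³, -((π : ℂ) ^ 2 / (Complex.I * t / 2)) * ‖w‖ ^ 2 =
      Complex.I * ((2 * π ^ 2 / t * ‖w‖ ^ 2 : ℝ) : ℂ) := by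
    intro w
    push_cast
    have : (t : ℂ) ≠ 0 := by simp [ht.ne']
    field_simp
    simp
  have hJ' : ‖J - g 0‖ ≤ 2 * π ^ 2 / t * M := by
    have hi : Integrable (fun w : ℝ³ =>
        h w * Complex.exp (-(π ^ 2 / (Complex.I * t / 2)) * ‖w‖ ^ 2)) := by
      refine (h.integrable (μ := volume)).mono
        (((h.continuous).mul (by fun_prop)).aestronglyMeasurable)
        (Eventually.of_forall fun w => ?_)
      rw [norm_mul, harg, mul_comm Complex.I, Complex.norm_exp_ofReal_mul_I, mul_one]
    rw [hJ, ← hg0, ← integral_sub hi (h.integrable (μ := volume)), hM, ← integral_const_mul]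
    refine norm_integral_le_of_norm_le ((h.integrable_pow_mul volume 2).const_mul _)
      (Eventually.of_forall fun w => ?_)
    rw [harg, show ∀ z : ℂ, h w * z - h w = h w * (z - 1) by intro z; ring, norm_mul]
    have := Real.norm_exp_I_mul_ofReal_sub_one_le (x := 2 * π ^ 2 / t * ‖w‖ ^ 2)
    rw [Real.norm_of_nonneg (by positivity)] at this
    calc _ ≤ ‖h w‖ * (2 * π ^ 2 / t * ‖w‖ ^ 2) := by gcongr
      _ = _ := by ring
  have hAn : ‖A‖ = (2 * π) ^ (3 / 2 : ℝ) * t ^ (-(3 / 2) : ℝ) := by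
    rw [hA, const_eq ht, norm_mul, Complex.norm_exp_ofReal_mul_I, mul_one, Complex.norm_real,
      Real.norm_of_nonneg (by positivity), Real.div_rpow two_pi_pos.le ht.le,
      Real.rpow_neg ht.le, div_eq_mul_inv]
  have ht52 : t ^ (-(5 : ℝ) / 2) = t ^ (-(3 / 2) : ℝ) * t⁻¹ := by
    rw [← Real.rpow_neg_one, ← Real.rpow_add ht]; norm_num
  rw [e1, fresnel_pairing g h hh ht, ← hA, ← hJ]
  have e2 : (A * J).re + 2 * π ^ ((3 : ℝ) / 2) * t ^ (-(3 : ℝ) / 2) * g 0 =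
      (A * (J - g 0)).re := by
    rw [mul_sub, Complex.sub_re, Complex.re_mul_ofReal, hA, const_re ht]
    ring
  rw [e2]
  calc _ ≤ ‖A * (J - g 0)‖ := Complex.abs_re_le_norm _
    _ = ‖A‖ * ‖J - g 0‖ := norm_mul _ _
    _ ≤ ((2 * π) ^ (3 / 2 : ℝ) * t ^ (-(3 / 2) : ℝ)) * (2 * π ^ 2 / t * M) := by
      rw [hAn]; gcongr
    _ = ((2 * π) ^ (3 / 2 : ℝ) * (2 * π ^ 2 * M)) * t ^ (-(5 : ℝ) / 2) := by
      rw [ht52]; ring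
    _ ≤ _ := by
      gcongr
      linarith
end
end

section
/- Let f, g : [0,∞) → ℝ be continuous, and let K, P : [0,∞) → ℝ be continuously differentiable with K(0) = 1, K'(t) = −∫₀ᵗ f(t−s) K(s) ds for all t ≥ 0, and P'(t) = −∫₀ᵗ f(t−s) P(s) ds + g(t) for all t ≥ 0. Then for every t ≥ 0: P(t) = K(t) P(0) + ∫₀ᵗ K(t−s) g(s) ds. -/
open MeasureTheory intervalIntegral

noncomputable section

lemma tri_aux (H : ℝ → ℝ → ℝ) (t s : ℝ) (ht : 0 ≤ t) (hs : s ∈ Set.Ioc 0 t) :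
    ∫ r in (0:ℝ)..(t - s), H s r
      = ∫ r in Set.Ioc 0 t, {p : ℝ × ℝ | p.1 + p.2 ≤ t}.indicator (Function.uncurry H) (s, r) := by
  rw [intervalIntegral.integral_of_le (by linarith [hs.2])]
  have h1 : ∀ r, {p : ℝ × ℝ | p.1 + p.2 ≤ t}.indicator (Function.uncurry H) (s, r)
      = (Set.Iic (t - s)).indicator (H s) r := by
    intro r
    by_cases h : s + r ≤ t
    · rw [Set.indicator_of_mem (by exact h), Set.indicator_of_mem (by simp; linarith)]; rfl
    · rw [Set.indicator_of_notMem (by exact h),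
        Set.indicator_of_notMem (by simp at h ⊢; linarith)]
  simp_rw [h1]
  rw [setIntegral_indicator measurableSet_Iic]
  congr 2
  ext r
  simp only [Set.mem_Ioc, Set.mem_inter_iff, Set.mem_Iic]
  have := hs.1
  constructor
  · rintro ⟨a, b⟩; exact ⟨⟨a, by linarith⟩, b⟩
  · rintro ⟨⟨a, _⟩, b⟩; exact ⟨a, b⟩

lemma tri_swap (H : ℝ → ℝ → ℝ) (hH : Continuous (Function.uncurry H)) (t : ℝ) (ht : 0 ≤ t) :
    ∫ s in (0:ℝ)..t, ∫ r in (0:ℝ)..(t - s), H s r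
      = ∫ r in (0:ℝ)..t, ∫ s in (0:ℝ)..(t - r), H s r := by
  rw [intervalIntegral.integral_of_le ht, intervalIntegral.integral_of_le ht]
  rw [setIntegral_congr_fun measurableSet_Ioc (fun s hs => tri_aux H t s ht hs),
    setIntegral_congr_fun measurableSet_Ioc (fun s hs => tri_aux (fun a b => H b a) t s ht hs)]
  rw [integral_integral_swap]
  · congr 1
    ext r
    congr 1
    ext s
    simp only [Set.indicator, Set.mem_setOf_eq, add_comm s r, Function.uncurry]
  · have hm : MeasurableSet {p : ℝ × ℝ | p.1 + p.2 ≤ t} :=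
      measurableSet_le (by fun_prop) (by fun_prop)
    have : Integrable (Function.uncurry H)
        ((volume.restrict (Set.Ioc 0 t)).prod (volume.restrict (Set.Ioc 0 t))) := by
      rw [Measure.prod_restrict]
      have h := hH.continuousOn.integrableOn_compact (μ := (volume : Measure ℝ).prod volume)
        ((isCompact_Icc (a := (0:ℝ)) (b := t)).prod (isCompact_Icc (a := (0:ℝ)) (b := t)))
      exact h.mono_set (Set.prod_mono Set.Ioc_subset_Icc_self Set.Ioc_subset_Icc_self)
    exact this.indicator hm

lemma ext_cont (K K' : ℝ → ℝ) (hK : ∀ t : ℝ, 0 ≤ t → HasDerivAt K (K' t) t) :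
    Continuous fun s => K (max 0 s) := by
  rw [continuous_iff_continuousAt]
  intro s
  exact ContinuousAt.comp (f := fun s => max (0:ℝ) s) (hK _ (le_max_left _ _)).continuousAt
    (by fun_prop)

lemma conv_cont (f K : ℝ → ℝ) (hf : Continuous f) (hK : Continuous K) :
    Continuous fun s => ∫ r in (0:ℝ)..s, f (s - r) * K r :=
  intervalIntegral.continuous_parametric_intervalIntegral_of_continuous (by fun_prop) continuous_id

lemma conv_eq (f K : ℝ → ℝ) (s : ℝ) (hs : 0 ≤ s) :
    ∫ r in (0:ℝ)..s, f (s - r) * K r = ∫ r in (0:ℝ)..s, f (s - r) * K (max 0 r) := by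
  apply intervalIntegral.integral_congr
  intro r hr
  rw [Set.uIcc_of_le hs] at hr
  simp [max_eq_right hr.1]

/-- Duhamel's principle for the convolution Volterra integro-differential equation:
if `K(0) = 1`, `K'(t) = -∫₀ᵗ f(t-s) K(s) ds` and `P'(t) = -∫₀ᵗ f(t-s) P(s) ds + g(t)`
for all `t ≥ 0`, then `P(t) = K(t) P(0) + ∫₀ᵗ K(t-s) g(s) ds` for all `t ≥ 0`. -/
theorem volterra_duhamel (f g K P : ℝ → ℝ)
    (hf : Continuous f) (hg : Continuous g)
    (hK0 : K 0 = 1)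
    (hK : ∀ t : ℝ, 0 ≤ t → HasDerivAt K (-∫ s in (0 : ℝ)..t, f (t - s) * K s) t)
    (hP : ∀ t : ℝ, 0 ≤ t →
      HasDerivAt P ((-∫ s in (0 : ℝ)..t, f (t - s) * P s) + g t) t) :
    ∀ t : ℝ, 0 ≤ t → P t = K t * P 0 + ∫ s in (0 : ℝ)..t, K (t - s) * g s := by
  intro t ht
  have cK := ext_cont K _ hK
  have cP := ext_cont P _ hP
  obtain ⟨K1, hK1⟩ : ∃ K1 : ℝ → ℝ, K1 = fun s => K (max 0 s) := ⟨_, rfl⟩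
  obtain ⟨P1, hP1⟩ : ∃ P1 : ℝ → ℝ, P1 = fun s => P (max 0 s) := ⟨_, rfl⟩
  rw [← hK1] at cK
  rw [← hP1] at cP
  have eK : ∀ s, 0 ≤ s → K s = K1 s := fun s hs => by simp [hK1, max_eq_right hs]
  have eP : ∀ s, 0 ≤ s → P s = P1 s := fun s hs => by simp [hP1, max_eq_right hs]
  obtain ⟨a, ha⟩ : ∃ a : ℝ → ℝ, a = fun s => ∫ r in (0:ℝ)..s, f (s - r) * K1 r := ⟨_, rfl⟩
  obtain ⟨b, hb⟩ : ∃ b : ℝ → ℝ, b = fun s => ∫ r in (0:ℝ)..s, f (s - r) * P1 r := ⟨_, rfl⟩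
  have ca : Continuous a := ha ▸ conv_cont f K1 hf cK
  have cb : Continuous b := hb ▸ conv_cont f P1 hf cP
  have dK : ∀ s, 0 ≤ s → HasDerivAt K (- a s) s := fun s hs => by
    have := hK s hs
    rw [conv_eq f K s hs] at this
    simpa [ha, hK1] using this
  have dP : ∀ s, 0 ≤ s → HasDerivAt P (- b s + g s) s := fun s hs => by
    have := hP s hs
    rw [conv_eq f P s hs] at this
    simpa [hb, hP1] using this
  have ftc : ∫ s in (0:ℝ)..t, (a (t - s) * P1 s - K1 (t - s) * b s + K1 (t - s) * g s)
      = K (t - t) * P t - K (t - 0) * P 0 := by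
    apply intervalIntegral.integral_eq_sub_of_hasDerivAt (f := fun s => K (t - s) * P s)
    · intro s hs
      rw [Set.uIcc_of_le ht] at hs
      have h1 : HasDerivAt (fun s => K (t - s)) (a (t - s)) s := by
        have := (dK (t - s) (by linarith [hs.2])).comp_const_sub t s
        simpa using this
      refine (h1.mul (dP s hs.1)).congr_deriv ?_
      rw [eP s hs.1, eK (t - s) (by linarith [hs.2])]
      ring
    · exact Continuous.intervalIntegrable (by fun_prop) _ _
  rw [intervalIntegral.integral_add (Continuous.intervalIntegrable (by fun_prop) _ _)
      (Continuous.intervalIntegrable (by fun_prop) _ _),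
    intervalIntegral.integral_sub (Continuous.intervalIntegrable (by fun_prop) _ _)
      (Continuous.intervalIntegrable (by fun_prop) _ _)] at ftc
  have key : ∫ s in (0:ℝ)..t, a (t - s) * P1 s = ∫ s in (0:ℝ)..t, K1 (t - s) * b s := by
    have h2 : ∫ s in (0:ℝ)..t, K1 (t - s) * b s = ∫ s in (0:ℝ)..t, K1 s * b (t - s) := by
      have := intervalIntegral.integral_comp_sub_left (a := 0) (b := t)
        (fun s => K1 s * b (t - s)) t
      simpa using this
    have h := tri_swap (fun s r => f (t - s - r) * K1 r * P1 s)
      (by simp only [Function.uncurry_def]; fun_prop) t ht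
    rw [h2]
    simp only [ha, hb]
    simp_rw [← intervalIntegral.integral_mul_const, ← intervalIntegral.integral_const_mul]
    rw [h]
    congr 1; ext r; congr 1; ext s
    rw [sub_right_comm]; ring
  have hg1 : ∫ s in (0:ℝ)..t, K (t - s) * g s = ∫ s in (0:ℝ)..t, K1 (t - s) * g s := by
    apply intervalIntegral.integral_congr
    intro s hs
    rw [Set.uIcc_of_le ht] at hs
    simp only
    rw [eK (t - s) (by linarith [hs.2])]
  rw [key, sub_self t, hK0, sub_zero] at ftc
  rw [hg1]
  linarith
end
end

section
/- Let g : ℝ³ → ℂ be a Schwartz function. There exists a constant C > 0 such that for all t ≥ 1: | ∫_{ℝ³} g(k) ‖k‖^{−2} e^{−i‖k‖² t/2} dk | ≤ C t^{−1/2}. -/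
open MeasureTheory Filter Real SchwartzMap

noncomputable section

local notation "ℝ³" => EuclideanSpace ℝ (Fin 3)

lemma aux_schwartz_bound {F : Type*} [NormedAddCommGroup F] [NormedSpace ℝ F] (f : 𝓢(ℝ³, F)) :
    ∃ K > (0 : ℝ), ∀ x, ‖f x‖ ≤ K * (1 + ‖x‖ ^ 2)⁻¹ := by
  obtain ⟨A, hA, hA'⟩ := f.decay 0 0
  obtain ⟨B, hB, hB'⟩ := f.decay 2 0
  refine ⟨A + B, by positivity, fun x => ?_⟩
  have h1 := hA' x
  have h2 := hB' x
  simp only [norm_iteratedFDeriv_zero, pow_zero, one_mul] at h1 h2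
  rw [← div_eq_mul_inv, le_div_iff₀ (by positivity)]
  nlinarith

lemma aux_norm_exp (t r : ℝ) : ‖Complex.exp (-Complex.I * (r : ℂ) ^ 2 * (t : ℂ) / 2)‖ = 1 := by
  have : -Complex.I * (r : ℂ) ^ 2 * (t : ℂ) / 2 = ((-(r ^ 2 * t / 2) : ℝ) : ℂ) * Complex.I := by
    push_cast; ring
  rw [this, Complex.norm_exp_ofReal_mul_I]

lemma aux_osc (φ φ' : ℝ → ℂ) (K : ℝ) (hK : 0 < K) (hd : ∀ r, HasDerivAt φ (φ' r) r)
    (hc : Continuous φ') (h0 : ∀ r, ‖φ r‖ ≤ K * (1 + r ^ 2)⁻¹)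
    (h1 : ∀ r, ‖φ' r‖ ≤ K * (1 + r ^ 2)⁻¹) (t a : ℝ) (ha : 0 < a) (hat : a ^ 2 * t = 1) :
    ‖∫ r in Set.Ioi (0 : ℝ), φ r * Complex.exp (-Complex.I * (r : ℂ) ^ 2 * (t : ℂ) / 2)‖
      ≤ K * (3 + π) * a := by
  have ht : 0 < t := by
    by_contra h
    nlinarith [mul_nonneg (sq_nonneg a) (neg_nonneg.2 (not_lt.1 h))]
  have hat' : (a * t)⁻¹ = a := by
    rw [inv_eq_iff_eq_inv]
    field_simp
    linarith
  set E : ℝ → ℂ := fun r => Complex.exp (-Complex.I * (r : ℂ) ^ 2 * (t : ℂ) / 2) with hE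
  have hEn : ∀ r, ‖E r‖ = 1 := aux_norm_exp t
  have hEc : Continuous E := by rw [hE]; fun_prop
  have hφc : Continuous φ := continuous_iff_continuousAt.2 fun r => (hd r).continuousAt
  have hK0 : ∀ r, ‖φ r‖ ≤ K := fun r => (h0 r).trans (by
    have : (1 + r ^ 2)⁻¹ ≤ 1 := inv_le_one_of_one_le₀ (by nlinarith [sq_nonneg r])
    nlinarith)
  have hIint : Integrable (fun r : ℝ => K * (1 + r ^ 2)⁻¹) := integrable_inv_one_add_sq.const_mul K
  have hint : Integrable (fun r => φ r * E r) := by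
    refine hIint.mono' (hφc.mul hEc).aestronglyMeasurable (Eventually.of_forall fun r => ?_)
    rw [norm_mul, hEn, mul_one]; exact h0 r
  have hEd : ∀ r, HasDerivAt E (E r * (-Complex.I * r * t)) r := by
    intro r
    have h2 : HasDerivAt (fun z : ℂ => Complex.exp (-Complex.I * z ^ 2 * (t : ℂ) / 2))
        (E r * (-Complex.I * r * t)) (r : ℂ) := by
      have := ((((hasDerivAt_pow 2 (r : ℂ)).const_mul (-Complex.I)).mul_const (t : ℂ)).div_const
        2).cexp
      refine this.congr_deriv ?_
      simp only [hE]
      push_cast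
      ring
    exact h2.comp_ofReal
  -- the primitive
  set H : ℝ → ℂ := fun r => φ r * E r * (Complex.I / t * (r : ℂ)⁻¹) with hH
  set G : ℝ → ℂ := fun r => (φ' r * (r : ℂ)⁻¹ - φ r * ((r : ℂ) ^ 2)⁻¹) * E r * (Complex.I / t) with hG
  have hIt : ‖Complex.I / (t : ℂ)‖ = t⁻¹ := by
    rw [norm_div, Complex.norm_I, Complex.norm_real, Real.norm_of_nonneg ht.le, one_div]
  have hHd : ∀ r ∈ Set.Ici a, HasDerivAt H (φ r * E r + G r) r := by
    intro r hr
    have hr0 : (r : ℂ) ≠ 0 := by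
      exact_mod_cast (lt_of_lt_of_le ha hr).ne'
    have ht0 : (t : ℂ) ≠ 0 := by exact_mod_cast ht.ne'
    have hinv : HasDerivAt (fun r : ℝ => (r : ℂ)⁻¹) (-((r : ℂ) ^ 2)⁻¹) r :=
      (hasDerivAt_inv hr0).comp_ofReal
    have := ((hd r).mul (hEd r)).mul (hinv.const_mul (Complex.I / t))
    refine this.congr_deriv ?_
    simp only [hG, Pi.mul_apply]
    field_simp
    ring_nf
    simp only [Complex.I_sq]
    ring
  have hbint : IntegrableOn (fun r : ℝ => a * (K * (1 + r ^ 2)⁻¹) + K / t * r ^ (-2 : ℝ))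
      (Set.Ioi a) :=
    (hIint.const_mul a).integrableOn.add
      ((integrableOn_Ioi_rpow_of_lt (by norm_num) ha).const_mul _)
  have hGb : ∀ r ∈ Set.Ioi a, ‖G r‖ ≤ a * (K * (1 + r ^ 2)⁻¹) + K / t * r ^ (-2 : ℝ) := by
    intro r hr
    have hr' : a < r := hr
    have hr0 : 0 < r := ha.trans hr'
    rw [Real.rpow_neg hr0.le, Real.rpow_two]
    simp only [hG]
    rw [norm_mul, norm_mul, hEn, hIt, mul_one]
    have e1 : ‖φ' r * (r : ℂ)⁻¹ - φ r * ((r : ℂ) ^ 2)⁻¹‖ ≤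
        (K * (1 + r ^ 2)⁻¹) * a⁻¹ + K * (r ^ 2)⁻¹ := by
      refine (norm_sub_le _ _).trans ?_
      rw [norm_mul, norm_mul, norm_inv, norm_inv, norm_pow, Complex.norm_real,
        Real.norm_of_nonneg hr0.le]
      gcongr
      · exact h1 r
      · exact hK0 r
    refine (mul_le_mul_of_nonneg_right e1 (by positivity)).trans (le_of_eq ?_)
    have hat2 : a = a⁻¹ * t⁻¹ := by rw [← mul_inv, hat']
    linear_combination (-(K * (1 + r ^ 2)⁻¹)) * hat2
  have hGm : AEStronglyMeasurable G (volume.restrict (Set.Ioi a)) := by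
    have hGc : Measurable G := by
      have := hc.measurable
      have := hφc.measurable
      have := hEc.measurable
      simp only [hG]
      fun_prop
    exact hGc.aestronglyMeasurable
  have hGi : IntegrableOn G (Set.Ioi a) :=
    Integrable.mono' hbint hGm ((ae_restrict_iff' measurableSet_Ioi).2 (Eventually.of_forall hGb))
  have hHt : Tendsto H atTop (nhds 0) := by
    have hb : Tendsto (fun r : ℝ => K * t⁻¹ * r⁻¹) atTop (nhds 0) := by
      simpa using tendsto_inv_atTop_zero.const_mul (K * t⁻¹)
    refine squeeze_zero_norm' ?_ hb
    filter_upwards [eventually_gt_atTop 0] with r hr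
    simp only [hH]
    rw [norm_mul, norm_mul, norm_mul, hEn, hIt, norm_inv, Complex.norm_real,
      Real.norm_of_nonneg hr.le, mul_one, mul_assoc K]
    gcongr
    exact hK0 r
  have key := integral_Ioi_of_hasDerivAt_of_tendsto' hHd (hint.integrableOn.add hGi) hHt
  rw [integral_add hint.integrableOn hGi, zero_sub] at key
  have hHa : ‖H a‖ ≤ K * a := by
    simp only [hH]
    rw [norm_mul, norm_mul, norm_mul, hEn, hIt, norm_inv, Complex.norm_real,
      Real.norm_of_nonneg ha.le, mul_one, ← mul_inv, mul_comm t, hat']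
    gcongr
    exact hK0 a
  have hGI : ‖∫ r in Set.Ioi a, G r‖ ≤ a * (K * π) + K * a := by
    refine (norm_integral_le_of_norm_le hbint
      ((ae_restrict_iff' measurableSet_Ioi).2 (Eventually.of_forall hGb))).trans ?_
    rw [integral_add (hIint.const_mul a).integrableOn
      ((integrableOn_Ioi_rpow_of_lt (by norm_num) ha).const_mul _), integral_const_mul,
      integral_const_mul, integral_const_mul, integral_Ioi_rpow_of_lt (by norm_num) ha]
    have e1 : ∫ r in Set.Ioi a, (1 + r ^ 2)⁻¹ ≤ π := by
      rw [← integral_univ_inv_one_add_sq]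
      exact setIntegral_le_integral integrable_inv_one_add_sq
        (Eventually.of_forall fun r => by positivity)
    have e2 : K / t * (-a ^ ((-2 : ℝ) + 1) / (-2 + 1)) = K * a := by
      have : ((-2 : ℝ) + 1) = -1 := by norm_num
      rw [this, Real.rpow_neg_one, neg_div_neg_eq, div_one]
      conv_rhs => rw [← hat']
      field_simp
    rw [e2]
    gcongr
  have hsmall : ‖∫ r in Set.Ioc 0 a, φ r * E r‖ ≤ K * a := by
    have := norm_setIntegral_le_of_norm_le_const (μ := volume) (s := Set.Ioc 0 a) (C := K)
      (f := fun r => φ r * E r) (by simp) (fun r _ => by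
        rw [norm_mul, hEn, mul_one]; exact hK0 r)
    simpa [ha.le] using this
  have hsplit : ∫ r in Set.Ioi 0, φ r * E r =
      (∫ r in Set.Ioc 0 a, φ r * E r) + ∫ r in Set.Ioi a, φ r * E r := by
    rw [← Set.Ioc_union_Ioi_eq_Ioi ha.le]
    exact setIntegral_union (Set.Ioc_disjoint_Ioi le_rfl) measurableSet_Ioi
      hint.integrableOn hint.integrableOn
  rw [hsplit, show ∫ r in Set.Ioi a, φ r * E r = -H a - ∫ r in Set.Ioi a, G r from
    eq_sub_of_add_eq key]
  calc _ ≤ ‖∫ r in Set.Ioc 0 a, φ r * E r‖ + (‖-H a‖ + ‖∫ r in Set.Ioi a, G r‖) :=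
        (norm_add_le _ _).trans (by gcongr; exact norm_sub_le _ _)
    _ ≤ K * a + (K * a + (a * (K * π) + K * a)) := by
        rw [norm_neg]; gcongr
    _ = _ := by ring

lemma aux_polar (f : ℝ³ → ℂ) (B : ℝ) (hB : 0 ≤ B)
    (h : ∀ ω : ℝ³, ‖ω‖ = 1 → ‖∫ r in Set.Ioi (0 : ℝ), (r ^ 2 : ℝ) • f (r • ω)‖ ≤ B) :
    ‖∫ x, f x‖ ≤ B * (volume : Measure ℝ³).toSphere.real Set.univ := by
  have hdim : Module.finrank ℝ ℝ³ - 1 = 2 := by simp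
  have e1 : ∫ x, f x = ∫ p, f ((p.2 : ℝ) • (p.1 : ℝ³))
      ∂((volume : Measure ℝ³).toSphere.prod (.volumeIoiPow 2)) := by
    have e0 : ∫ x, f x = ∫ x : ({(0 : ℝ³)}ᶜ : Set ℝ³), f x.1 ∂((volume : Measure ℝ³).comap (↑)) := by
      rw [integral_subtype_comap (measurableSet_singleton _).compl f, restrict_compl_singleton]
    rw [e0, ← hdim]
    rw [← (volume : Measure ℝ³).measurePreserving_homeomorphUnitSphereProd.integral_comp
      (Homeomorph.measurableEmbedding _)]
    congr 1
    ext x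
    congr 1
    have hx : ‖x.1‖ ≠ 0 := norm_ne_zero_iff.2 x.2
    simp [smul_smul, hx]
  rw [e1]
  by_cases hi : Integrable (fun p : Metric.sphere (0 : ℝ³) 1 × Set.Ioi (0 : ℝ) =>
      f ((p.2 : ℝ) • (p.1 : ℝ³))) ((volume : Measure ℝ³).toSphere.prod (.volumeIoiPow 2))
  · rw [integral_prod _ hi]
    refine norm_integral_le_of_norm_le_const (Eventually.of_forall fun ω => ?_)
    have e2 : ∫ r : Set.Ioi (0 : ℝ), f ((r : ℝ) • (ω : ℝ³)) ∂(Measure.volumeIoiPow 2) =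
        ∫ r in Set.Ioi (0 : ℝ), (r ^ 2 : ℝ) • f (r • (ω : ℝ³)) := by
      simp only [Measure.volumeIoiPow, ENNReal.ofReal]
      rw [integral_withDensity_eq_integral_smul,
        integral_subtype_comap measurableSet_Ioi
          fun a ↦ Real.toNNReal (a ^ 2) • f (a • (ω : ℝ³)),
        setIntegral_congr_fun measurableSet_Ioi fun x hx ↦ ?_]
      · rw [NNReal.smul_def, Real.coe_toNNReal _ (pow_nonneg hx.out.le _)]
      · exact (measurable_subtype_coe.pow_const _).real_toNNReal
    rw [e2]
    exact h ω (by simp)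
  · rw [integral_undef hi, norm_zero]
    positivity

/-- Decay of the pairing with an inverse Laplacian: for Schwartz `g`,
`| ∫ g(k) ‖k‖⁻² e^{-i‖k‖²t/2} dk | ≤ C t^{-1/2}` for `t ≥ 1`. -/
theorem inverse_laplacian_propagator_decay (g : 𝓢(ℝ³, ℂ)) :
    ∃ C > (0 : ℝ), ∀ t : ℝ, 1 ≤ t →
      ‖∫ k : ℝ³, g k * ((‖k‖ : ℂ) ^ 2)⁻¹ *
          Complex.exp (-Complex.I * (‖k‖ : ℂ) ^ 2 * (t : ℂ) / 2)‖ ≤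
        C * t ^ (-(1 : ℝ) / 2) := by
  obtain ⟨A, hA, hA'⟩ := aux_schwartz_bound g
  obtain ⟨B, hB, hB'⟩ := aux_schwartz_bound (SchwartzMap.fderivCLM ℝ ℝ³ ℂ g)
  set S : ℝ := (volume : Measure ℝ³).toSphere.real Set.univ with hS
  have hS0 : 0 ≤ S := measureReal_nonneg
  have hpi := Real.pi_pos
  refine ⟨(A + B) * (3 + π) * (S + 1), by positivity, fun t ht => ?_⟩
  have ht0 : 0 < t := by linarith
  set a : ℝ := t ^ (-(1 : ℝ) / 2) with ha
  have ha0 : 0 < a := Real.rpow_pos_of_pos ht0 _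
  have hat : a ^ 2 * t = 1 := by
    rw [ha, ← Real.rpow_natCast, ← Real.rpow_mul ht0.le]
    norm_num
    rw [Real.rpow_neg_one]
    field_simp
  refine (aux_polar _ ((A + B) * (3 + π) * a) (by positivity) fun ω hω => ?_).trans ?_
  · have hn : ∀ r : ℝ, ‖r • ω‖ ^ 2 = r ^ 2 := fun r => by
      rw [norm_smul, hω, mul_one, Real.norm_eq_abs, sq_abs]
    have := aux_osc (fun r => g (r • ω)) (fun r => fderiv ℝ g (r • ω) ω) (A + B) (by positivity)
      (fun r => by
        have h1 : HasDerivAt (fun r : ℝ => r • ω) ω r := by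
          simpa using (hasDerivAt_id r).smul_const ω
        exact (g.differentiableAt (x := r • ω)).hasFDerivAt.comp_hasDerivAt r h1)
      (by
        have h2 : Continuous (fun x => SchwartzMap.fderivCLM ℝ ℝ³ ℂ g x) :=
          (SchwartzMap.fderivCLM ℝ ℝ³ ℂ g).continuous
        have h3 : Continuous (fun r : ℝ => SchwartzMap.fderivCLM ℝ ℝ³ ℂ g (r • ω) ω) :=
          (h2.comp (by fun_prop : Continuous fun r : ℝ => r • ω)).clm_apply continuous_const
        exact h3)
      (fun r => by
        have := hA' (r • ω)
        rw [hn] at this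
        refine this.trans ?_
        gcongr
        linarith)
      (fun r => by
        have := hB' (r • ω)
        rw [hn] at this
        refine (ContinuousLinearMap.le_opNorm _ _).trans ?_
        rw [hω, mul_one]
        refine this.trans ?_
        gcongr
        linarith) t a ha0 hat
    refine le_of_eq_of_le ?_ this
    congr 1
    refine setIntegral_congr_fun measurableSet_Ioi fun r hr => ?_
    have hr0 : (r : ℂ) ≠ 0 := by exact_mod_cast (ne_of_gt hr)
    have hn' : (‖r • ω‖ : ℂ) ^ 2 = (r : ℂ) ^ 2 := by exact_mod_cast hn r
    simp only [hn', Complex.real_smul]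
    push_cast
    field_simp
  · have : 0 ≤ (A + B) * (3 + π) * a := by positivity
    nlinarith
end
end
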